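/- Let κ > 0, let m ≥ 1 be an integer, and let ε ∈ (0, 1/(κ+1)). Define L_κ(x) = −Σ_{ℓ≥1} log(1 − e^{−x·⌊ℓ^κ⌋}) for x > 0. Then there exist C > 0 and N₀ such that for every integer n ≥ N₀ there is a real y > 0 satisfying L_κ'(y) − (m+1)·L_κ'((m+1)y) + n = 0 and | p_{κ,m}(n) · √(2π·(L_κ''(y) − (m+1)²·L_κ''((m+1)y))) · e^{−(L_κ(y) − L_κ((m+1)y)) − n·y} − 1 | ≤ C·n^{−1/(κ+1)+ε}. -/

import Mathlib

open Filter Topology Real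

/-- The Piatetski-Shapiro part: `⌊ℓ^κ⌋`. -/
noncomputable def psPart (κ : ℝ) (ℓ : ℕ) : ℕ := ⌊(ℓ : ℝ) ^ κ⌋₊

/-- `p_{κ,m}(n)`: number of partitions of `n` into parts from `(⌊ℓ^κ⌋)_{ℓ ≥ 1}`,
each index used at most `m` times. -/
noncomputable def pkm (κ : ℝ) (m : ℕ) (n : ℕ) : ℕ :=
  Nat.card {r : ℕ →₀ ℕ // (∀ ℓ, r ℓ ≤ m) ∧ (r.sum fun ℓ j => j * psPart κ (ℓ + 1)) = n}

/-- `L_κ(x) = -∑_{ℓ ≥ 1} log(1 - e^{-x⌊ℓ^κ⌋})`. -/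
noncomputable def Lk (κ : ℝ) (x : ℝ) : ℝ :=
  -∑' ℓ : ℕ, Real.log (1 - Real.exp (-x * (psPart κ (ℓ + 1) : ℝ)))

/-! ### Finite differences of power functions -/

/-- Bounds for the `k`-th derivative transfer to `k`-fold forward differences. -/
lemma fwdDiff_iter_mem_Icc (k : ℕ) : ∀ (h : ℕ → ℝ → ℝ) (s x m M : ℝ), 0 < s → 0 < x →
    (∀ i < k, ∀ t > 0, HasDerivAt (h i) (h (i + 1) t) t) →
    (∀ t ∈ Set.Icc x (x + k * s), h k t ∈ Set.Icc m M) →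
    (fwdDiff s)^[k] (h 0) x ∈ Set.Icc (m * s ^ k) (M * s ^ k) := by
  induction k with
  | zero =>
    intro h s x m M hs hx _ hb
    simpa using hb x (by simp)
  | succ k ih =>
    intro h s x m M hs hx hd hb
    rw [Function.iterate_succ_apply]
    have := ih (fun i => fwdDiff s (h i)) s x (m * s) (M * s) hs hx ?_ ?_
    · rw [pow_succ', ← mul_assoc, ← mul_assoc]
      exact this
    · intro i hi t ht
      have h1 := hd i (by omega) t ht
      have h2 := (hd i (by omega) (t + s) (by positivity)).comp_add_const t s
      exact h2.sub h1
    · intro t ht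
      have ht0 : 0 < t := hx.trans_le ht.1
      obtain ⟨c, hc, hc'⟩ := exists_hasDerivAt_eq_slope (h k) (h (k + 1)) (a := t) (b := t + s)
        (by linarith)
        (fun u hu => (hd k (by omega) u (ht0.trans_le hu.1)).continuousAt.continuousWithinAt)
        (fun u hu => hd k (by omega) u (ht0.trans hu.1))
      have hcb := hb c ⟨ht.1.trans hc.1.le, by
        have := ht.2; have := hc.2; push_cast; nlinarith⟩
      have e : fwdDiff s (h k) t = h (k + 1) c * s := by
        rw [hc', add_sub_cancel_left, div_mul_cancel₀ _ hs.ne']; rfl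
      rw [e]
      exact ⟨mul_le_mul_of_nonneg_right hcb.1 hs.le, mul_le_mul_of_nonneg_right hcb.2 hs.le⟩

/-- The coefficient `κ (κ - 1) ⋯ (κ - i + 1)` of the `i`-th derivative of `x ^ κ`. -/
noncomputable def rpowCoeff (κ : ℝ) (i : ℕ) : ℝ := ∏ j ∈ Finset.range i, (κ - j)

lemma rpowCoeff_zero (κ : ℝ) : rpowCoeff κ 0 = 1 := by simp [rpowCoeff]

lemma rpowCoeff_succ (κ : ℝ) (i : ℕ) : rpowCoeff κ (i + 1) = rpowCoeff κ i * (κ - i) := by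
  simp [rpowCoeff, Finset.prod_range_succ]

lemma rpowCoeff_pos {κ : ℝ} {i : ℕ} (h : ∀ j < i, (j : ℝ) < κ) : 0 < rpowCoeff κ i :=
  Finset.prod_pos fun j hj => sub_pos.2 (h j (Finset.mem_range.1 hj))

lemma hasDerivAt_rpowCoeff_mul (κ θ : ℝ) (i : ℕ) (t : ℝ) (ht : 0 < t) :
    HasDerivAt (fun x : ℝ => θ * rpowCoeff κ i * x ^ (κ - i))
      (θ * rpowCoeff κ (i + 1) * t ^ (κ - (i + 1 : ℕ))) t := by
  have := (hasDerivAt_rpow_const (x := t) (p := κ - i) (Or.inl ht.ne')).const_mul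
    (θ * rpowCoeff κ i)
  convert! this using 1
  rw [rpowCoeff_succ]; push_cast
  rw [← sub_sub]; ring

/-! ### Distance to the nearest integer -/

/-- Distance to the nearest integer. -/
noncomputable def distInt (x : ℝ) : ℝ := |x - round x|

lemma distInt_nonneg (x : ℝ) : 0 ≤ distInt x := abs_nonneg _

lemma distInt_le (x : ℝ) (z : ℤ) : distInt x ≤ |x - z| := round_le x z

lemma distInt_neg (x : ℝ) : distInt (-x) = distInt x := by
  have key : ∀ y : ℝ, distInt (-y) ≤ distInt y := fun y => by
    refine (distInt_le (-y) (-round y)).trans (le_of_eq ?_)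
    rw [distInt, ← abs_neg (y - _)]; push_cast; ring_nf
  refine le_antisymm (key x) ?_
  simpa using key (-x)

lemma distInt_add_le (x y : ℝ) : distInt (x + y) ≤ distInt x + |y| := by
  refine (distInt_le _ (round x)).trans ?_
  rw [show x + y - round x = (x - round x) + y by ring]
  exact abs_add_le _ _

lemma distInt_sub_le (x y : ℝ) : distInt (x - y) ≤ distInt x + distInt y := by
  refine (distInt_le _ (round x - round y)).trans ?_
  push_cast
  rw [show x - y - (round x - round y) = (x - round x) - (y - round y) by ring]
  exact abs_sub _ _

lemma distInt_eq_abs {x : ℝ} (hx : |x| ≤ 1 / 2) : distInt x = |x| := by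
  refine le_antisymm (by simpa using distInt_le x 0) ?_
  rw [distInt]
  rcases eq_or_ne (round x) 0 with h | h
  · simp [h]
  · have h1 : (1 : ℝ) ≤ |(round x : ℝ)| := by exact_mod_cast Int.one_le_abs h
    have := abs_sub_abs_le_abs_sub (round x : ℝ) x
    rw [abs_sub_comm] at this
    linarith

lemma distInt_natCast_mul_le (q : ℕ) (x : ℝ) : distInt (q * x) ≤ q * distInt x := by
  refine (distInt_le _ (q * round x)).trans (le_of_eq ?_)
  push_cast
  rw [← mul_sub, abs_mul, Nat.abs_cast, distInt]

lemma distInt_sub_intCast_mul (x : ℝ) (z : ℤ) : distInt (x - z) = distInt x := by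
  simp [distInt]

lemma distInt_fwdDiff_iter_le (k : ℕ) : ∀ (f : ℝ → ℝ) (s x r : ℝ),
    (∀ i ≤ k, distInt (f (x + i * s)) ≤ r) → distInt ((fwdDiff s)^[k] f x) ≤ 2 ^ k * r := by
  induction k with
  | zero => intro f s x r h; simpa using h 0 le_rfl
  | succ k ih =>
    intro f s x r h
    rw [Function.iterate_succ_apply, pow_succ, mul_assoc]
    refine ih _ s x (2 * r) fun i hi => ?_
    have h1 := h i (by omega)
    have h2 := h (i + 1) (by omega)
    rw [fwdDiff, show x + i * s + s = x + ((i + 1 : ℕ) : ℝ) * s by push_cast; ring]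
    exact (distInt_sub_le _ _).trans (by linarith)

/-! ### The Piatetski-Shapiro parts -/

lemma psPart_le (κ : ℝ) (ℓ : ℕ) : (psPart κ ℓ : ℝ) ≤ (ℓ : ℝ) ^ κ := Nat.floor_le (by positivity)

lemma lt_psPart_add_one (κ : ℝ) (ℓ : ℕ) : (ℓ : ℝ) ^ κ < psPart κ ℓ + 1 := Nat.lt_floor_add_one _

lemma one_le_psPart {κ : ℝ} (hκ : 0 < κ) (ℓ : ℕ) : 1 ≤ psPart κ (ℓ + 1) := by
  refine Nat.le_floor ?_
  push_cast
  exact one_le_rpow (by simp) hκ.le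

lemma rpow_div_two_le_psPart {κ : ℝ} (hκ : 0 < κ) (ℓ : ℕ) :
    ((ℓ : ℝ) + 1) ^ κ / 2 ≤ psPart κ (ℓ + 1) := by
  have h1 := lt_psPart_add_one κ (ℓ + 1)
  have h2 : (1 : ℝ) ≤ psPart κ (ℓ + 1) := by exact_mod_cast one_le_psPart hκ ℓ
  push_cast at h1
  linarith

/-- Lower bound for the mean square distance to the integers at small frequencies. -/
lemma exists_sum_distInt_sq_of_small {κ : ℝ} (hκ : 0 < κ) :
    ∃ C₀ > 0, ∃ c > 0, ∃ c' > 0, c ≤ 1 / 2 ∧ ∀ P : ℕ, 1 ≤ P → ∀ α : ℝ,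
      C₀ * (P : ℝ) ^ (-κ) ≤ α → α ≤ c →
      c' * P ≤ ∑ ℓ ∈ Finset.range (3 * P), distInt (α * psPart κ (ℓ + 1)) ^ 2 := by
  set k := ⌈κ⌉₊ with hk
  have hk1 : 1 ≤ k := Nat.one_le_iff_ne_zero.2 (by simpa [hk] using hκ)
  have hκk : κ ≤ k := Nat.le_ceil κ
  have hlt : ∀ j < k, (j : ℝ) < κ := fun j hj => Nat.lt_ceil.1 hj
  set c₂ := rpowCoeff κ k with hc₂
  have hc₂0 : 0 < c₂ := rpowCoeff_pos hlt
  set c₁ := c₂ * (3 : ℝ) ^ (κ - k) with hc₁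
  have hc₁0 : 0 < c₁ := by positivity
  set t := c₁ / (c₂ * 2 ^ (k + 1)) with ht
  have ht0 : 0 < t := by positivity
  set c := min (t / 2 ^ (k + 2)) (min (1 / (2 * c₂)) (1 / 2)) with hc
  have hc0 : 0 < c := by positivity
  have hct : c ≤ t / 2 ^ (k + 2) := min_le_left _ _
  have hcc : c ≤ 1 / (2 * c₂) := (min_le_right _ _).trans (min_le_left _ _)
  have hc12 : c ≤ 1 / 2 := (min_le_right _ _).trans (min_le_right _ _)
  have hk0 : (0 : ℝ) < k := by exact_mod_cast hk1
  refine ⟨k ^ k / (2 * c₂), by positivity, c, hc0, c ^ 2 / (k + 1), by positivity, hc12, ?_⟩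
  intro P hP α hα hαc
  have hP0 : (0 : ℝ) < P := by exact_mod_cast hP
  have hα0 : 0 < α := lt_of_lt_of_le (by positivity) hα
  -- the step of the progression
  set X := 1 / (2 * α * c₂ * (P : ℝ) ^ (κ - k)) with hX
  have hX0 : 0 < X := by positivity
  set σ := X ^ (1 / (k : ℝ)) with hσ
  have hσ0 : 0 < σ := by positivity
  have hσk : σ ^ k = X := by
    rw [hσ, ← rpow_natCast, ← rpow_mul hX0.le]; field_simp; simp
  have hX1 : 1 ≤ X := by
    rw [hX, le_div_iff₀ (by positivity), one_mul]
    have h1 : (P : ℝ) ^ (κ - k) ≤ 1 :=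
      rpow_le_one_of_one_le_of_nonpos (by exact_mod_cast hP) (by linarith)
    have h2 : 2 * α * c₂ ≤ 1 := by
      have := mul_le_mul_of_nonneg_right (hαc.trans hcc) (by positivity : 0 ≤ 2 * c₂)
      rw [div_mul_cancel₀ _ (by positivity)] at this
      linarith
    nlinarith [show 0 < 2 * α * c₂ by positivity]
  have hσ1 : 1 ≤ σ := one_le_rpow hX1 (by positivity)
  have hσP : σ ≤ P / k := by
    refine le_of_pow_le_pow_left₀ (by omega : k ≠ 0) (by positivity) ?_
    rw [hσk, hX, div_pow, div_le_div_iff₀ (by positivity) (by positivity), one_mul]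
    have e : (P : ℝ) ^ (κ - k) * P ^ k = P ^ κ := by
      rw [← rpow_natCast, ← rpow_add hP0]; simp
    have h1 := mul_le_mul_of_nonneg_right hα (by positivity : 0 ≤ 2 * c₂ * (P : ℝ) ^ κ)
    have h2 : (P : ℝ) ^ (-κ) * (P : ℝ) ^ κ = 1 := by rw [← rpow_add hP0]; simp
    have h3 : (k : ℝ) ^ k / (2 * c₂) * P ^ (-κ) * (2 * c₂ * P ^ κ) = k ^ k := by
      rw [show (k : ℝ) ^ k / (2 * c₂) * P ^ (-κ) * (2 * c₂ * P ^ κ)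
        = (k : ℝ) ^ k / (2 * c₂) * (2 * c₂) * (P ^ (-κ) * P ^ κ) by ring, h2,
        div_mul_cancel₀ _ (by positivity), mul_one]
    rw [h3] at h1
    calc (k : ℝ) ^ k ≤ _ := h1
      _ = _ := by rw [← e]; ring
  set s := ⌊σ⌋₊ with hs
  have hs1 : 1 ≤ s := Nat.le_floor (by simpa using hσ1)
  have hs0 : (0 : ℝ) < s := by exact_mod_cast hs1
  have hsσ : (s : ℝ) ≤ σ := Nat.floor_le hσ0.le
  have hsσ2 : σ / 2 ≤ s := by
    have := Nat.lt_floor_add_one σ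
    have : (1 : ℝ) ≤ s := by exact_mod_cast hs1
    linarith
  have hksP : k * s ≤ P := by
    have : (k : ℝ) * s ≤ P := by
      have := hsσ.trans hσP
      rw [le_div_iff₀ hk0] at this
      linarith
    exact_mod_cast this
  -- every progression contains an element far from the integers
  have main : ∀ ℓ < P, ∃ i ≤ k, c < distInt (α * psPart κ (P + ℓ + i * s + 1)) := by
    intro ℓ hℓ
    by_contra! hcon
    set x : ℝ := P + ℓ + 1 with hx
    have hx0 : 0 < x := by positivity
    have hℓ' : (ℓ : ℝ) + 1 ≤ P := by exact_mod_cast hℓ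
    have hks' : (k : ℝ) * s ≤ P := by exact_mod_cast hksP
    have hb := fwdDiff_iter_mem_Icc k (fun i x => α * rpowCoeff κ i * x ^ (κ - i)) s x
      (α * c₁ * (P : ℝ) ^ (κ - k)) (α * c₂ * (P : ℝ) ^ (κ - k)) hs0 hx0
      (fun i _ t ht => hasDerivAt_rpowCoeff_mul κ α i t ht) ?_
    · have hnear : distInt ((fwdDiff (s : ℝ))^[k]
          (fun x : ℝ => α * rpowCoeff κ 0 * x ^ (κ - (0 : ℕ))) x) ≤ 2 ^ k * (2 * c) := by
        refine distInt_fwdDiff_iter_le k _ _ _ _ fun i hi => ?_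
        have h1 := hcon i hi
        have e : α * rpowCoeff κ 0 * (x + i * s) ^ (κ - (0 : ℕ))
            = α * psPart κ (P + ℓ + i * s + 1)
              + α * ((x + i * s) ^ κ - psPart κ (P + ℓ + i * s + 1)) := by
          rw [rpowCoeff_zero]; simp; ring
        rw [e]
        refine (distInt_add_le _ _).trans ?_
        have h2 := psPart_le κ (P + ℓ + i * s + 1)
        have h3 := lt_psPart_add_one κ (P + ℓ + i * s + 1)
        have e2 : ((P + ℓ + i * s + 1 : ℕ) : ℝ) = x + i * s := by rw [hx]; push_cast; ring
        rw [e2] at h2 h3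
        rw [abs_of_nonneg (mul_nonneg hα0.le (by linarith))]
        nlinarith
      have hpk : X / 2 ^ k ≤ (s : ℝ) ^ k := by
        rw [← hσk, ← div_pow]
        exact pow_le_pow_left₀ (by positivity) hsσ2 k
      have hpk2 : (s : ℝ) ^ k ≤ X := by
        rw [← hσk]; exact pow_le_pow_left₀ hs0.le hsσ k
      have hXe : α * c₂ * (P : ℝ) ^ (κ - k) * X = 1 / 2 := by
        rw [hX]; field_simp
      have hup := hb.2.trans (mul_le_mul_of_nonneg_left hpk2 (by positivity))
      rw [hXe] at hup
      have hlo := (mul_le_mul_of_nonneg_left hpk (by positivity :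
        0 ≤ α * c₁ * (P : ℝ) ^ (κ - k))).trans hb.1
      have e3 : α * c₁ * (P : ℝ) ^ (κ - k) * (X / 2 ^ k) = t := by
        rw [ht, show α * c₁ * (P : ℝ) ^ (κ - k) * (X / 2 ^ k)
          = (α * c₂ * (P : ℝ) ^ (κ - k) * X) * (c₁ / (c₂ * 2 ^ k)) by field_simp, hXe, pow_succ]
        field_simp
      rw [e3] at hlo
      have hpos := ht0.trans_le hlo
      rw [distInt_eq_abs (by rw [abs_of_pos hpos]; exact hup), abs_of_pos hpos] at hnear
      have : 2 ^ k * (2 * c) ≤ t / 2 := by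
        calc (2 : ℝ) ^ k * (2 * c) ≤ 2 ^ k * (2 * (t / 2 ^ (k + 2))) := by gcongr
          _ = t / 2 := by rw [pow_add]; field_simp
      linarith
    · intro u hu
      have hu1 : (P : ℝ) ≤ u := le_trans (by rw [hx]; linarith [Nat.cast_nonneg (α := ℝ) ℓ]) hu.1
      have hu2 : u ≤ 3 * P := hu.2.trans (by rw [hx]; linarith)
      have hu0 : 0 < u := hP0.trans_le hu1
      constructor
      · have : (3 : ℝ) ^ (κ - k) * (P : ℝ) ^ (κ - k) ≤ u ^ (κ - k) := by
          rw [← mul_rpow (by norm_num) hP0.le]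
          exact rpow_le_rpow_of_nonpos hu0 hu2 (by linarith)
        calc α * c₁ * (P : ℝ) ^ (κ - k) = α * c₂ * ((3 : ℝ) ^ (κ - k) * (P : ℝ) ^ (κ - k)) := by
              rw [hc₁]; ring
          _ ≤ _ := by gcongr
      · have : u ^ (κ - k) ≤ (P : ℝ) ^ (κ - k) := rpow_le_rpow_of_nonpos hP0 hu1 (by linarith)
        show α * c₂ * u ^ (κ - k) ≤ _
        gcongr
  -- summation
  set D : ℕ → ℝ := fun ℓ => distInt (α * psPart κ (ℓ + 1)) ^ 2 with hD
  have hD0 : ∀ ℓ, 0 ≤ D ℓ := fun ℓ => sq_nonneg _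
  have h1 : ∀ ℓ ∈ Finset.range P, c ^ 2 ≤ ∑ i ∈ Finset.range (k + 1), D (P + ℓ + i * s) := by
    intro ℓ hℓ
    obtain ⟨i, hi, hci⟩ := main ℓ (Finset.mem_range.1 hℓ)
    refine le_trans (pow_le_pow_left₀ hc0.le hci.le 2) ?_
    exact Finset.single_le_sum (f := fun i => D (P + ℓ + i * s)) (fun i _ => hD0 _)
      (Finset.mem_range.2 (by omega))
  have h2 : ∀ i ∈ Finset.range (k + 1), ∑ ℓ ∈ Finset.range P, D (P + ℓ + i * s)
      ≤ ∑ ℓ ∈ Finset.range (3 * P), D ℓ := by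
    intro i hi
    have his : i * s ≤ P := (Nat.mul_le_mul_right s
      (Nat.lt_succ_iff.1 (Finset.mem_range.1 hi))).trans hksP
    have hinj : Set.InjOn (fun ℓ => P + ℓ + i * s) (Finset.range P) := fun a _ b _ h => by
      simpa using h
    rw [← Finset.sum_image (f := D) (g := fun ℓ => P + ℓ + i * s) hinj]
    refine Finset.sum_le_sum_of_subset_of_nonneg ?_ fun _ _ _ => hD0 _
    intro j hj
    obtain ⟨ℓ, hℓ, rfl⟩ := Finset.mem_image.1 hj
    have := Finset.mem_range.1 hℓ
    exact Finset.mem_range.2 (by omega)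
  have h3 := Finset.sum_le_sum h1
  rw [Finset.sum_comm] at h3
  have h4 := h3.trans (Finset.sum_le_sum h2)
  simp only [Finset.sum_const, Finset.card_range, nsmul_eq_mul] at h4
  rw [div_mul_eq_mul_div, div_le_iff₀ (by positivity)]
  push_cast at h4
  linarith

/-! ### Exponential sums: van der Corput's method -/

/-- `e(x) = exp(2πix)`. -/
noncomputable def eTwoPi (x : ℝ) : ℂ := Complex.exp ((2 * π * x : ℝ) * Complex.I)

lemma norm_eTwoPi (x : ℝ) : ‖eTwoPi x‖ = 1 := Complex.norm_exp_ofReal_mul_I _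

lemma eTwoPi_add (x y : ℝ) : eTwoPi (x + y) = eTwoPi x * eTwoPi y := by
  rw [eTwoPi, eTwoPi, eTwoPi, ← Complex.exp_add]; congr 1; push_cast; ring

lemma eTwoPi_mul_conj (x y : ℝ) : eTwoPi x * (starRingEnd ℂ) (eTwoPi y) = eTwoPi (x - y) := by
  rw [eTwoPi, eTwoPi, eTwoPi, ← Complex.exp_conj, ← Complex.exp_add]; congr 1
  rw [map_mul, Complex.conj_ofReal, Complex.conj_I]; push_cast; ring

/-- The sequence `e(f n)` has mean value zero. -/
def MeanZero (f : ℕ → ℝ) : Prop :=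
  Tendsto (fun N : ℕ => (∑ n ∈ Finset.range N, eTwoPi (f n)) / N) atTop (𝓝 0)

/-- Fejér's criterion. -/
lemma meanZero_of_fejer (f : ℕ → ℝ) (hanti : Antitone fun n => f (n + 1) - f n)
    (hpos : ∀ n, 0 < f (n + 1) - f n)
    (h0 : Tendsto (fun n => f (n + 1) - f n) atTop (𝓝 0))
    (hinf : Tendsto (fun n : ℕ => n * (f (n + 1) - f n)) atTop atTop) : MeanZero f := by
  set d : ℕ → ℝ := fun n => f (n + 1) - f n with hd
  set E : ℕ → ℂ := fun n => eTwoPi (f n) with hE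
  have hEn : ∀ n, ‖E n‖ = 1 := fun n => norm_eTwoPi _
  set b : ℕ → ℝ := fun n => 1 / d n with hb
  have hbpos : ∀ n, 0 < b n := fun n => one_div_pos.2 (hpos n)
  have hbmono : Monotone b := fun m n h => one_div_le_one_div_of_le (hpos n) (hanti h)
  have abel : ∀ N, ‖(∑ n ∈ Finset.range N, b n * (E (n + 1) - E n)) - b N * E N‖ ≤ b N := by
    intro N
    induction N with
    | zero => simp [hEn, abs_of_pos (hbpos 0)]
    | succ N ih =>
      rw [Finset.sum_range_succ]
      have e : (∑ n ∈ Finset.range N, (b n : ℂ) * (E (n + 1) - E n)) + b N * (E (N + 1) - E N)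
          - b (N + 1) * E (N + 1) = ((∑ n ∈ Finset.range N, (b n : ℂ) * (E (n + 1) - E n))
          - b N * E N) - ((b (N + 1) - b N : ℝ) : ℂ) * E (N + 1) := by push_cast; ring
      rw [e]
      refine (norm_sub_le _ _).trans ?_
      rw [norm_mul, hEn, Complex.norm_real, norm_eq_abs,
        abs_of_nonneg (sub_nonneg.2 (hbmono (Nat.le_succ N)))]
      linarith
  have abel2 : ∀ N, ‖∑ n ∈ Finset.range N, (b n : ℂ) * (E (n + 1) - E n)‖ ≤ 2 * b N := by
    intro N
    have := norm_sub_norm_le (∑ n ∈ Finset.range N, (b n : ℂ) * (E (n + 1) - E n)) (b N * E N)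
    have h2 := abel N
    rw [norm_mul, hEn, Complex.norm_real, norm_eq_abs, abs_of_pos (hbpos N)] at this
    linarith
  have hlim : Tendsto (fun N : ℕ => 2 * b N / N) atTop (𝓝 0) := by
    have := (tendsto_inv_atTop_zero.comp hinf).const_mul 2
    rw [mul_zero] at this
    refine this.congr fun N => ?_
    simp only [hb, Function.comp, one_div, mul_inv, hd]; ring
  have key : ∀ᶠ n in atTop, ‖2 * π * Complex.I * E n - b n * (E (n + 1) - E n)‖
      ≤ (2 * π) ^ 2 * d n := by
    have : ∀ᶠ n in atTop, 2 * π * d n < 1 := by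
      have := h0.const_mul (2 * π)
      rw [mul_zero] at this
      exact this.eventually (gt_mem_nhds one_pos)
    filter_upwards [this] with n hn
    have e1 : E (n + 1) = E n * eTwoPi (d n) := by
      rw [hE]; simp only; rw [← eTwoPi_add, hd]; simp
    have hdn := hpos n
    have hz : ‖((2 * π * d n : ℝ) * Complex.I : ℂ)‖ = 2 * π * d n := by
      rw [norm_mul, Complex.norm_I, mul_one, Complex.norm_real, norm_eq_abs,
        abs_of_pos (by positivity)]
    have h2 := Complex.norm_exp_sub_one_sub_id_le (x := (2 * π * d n : ℝ) * Complex.I)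
      (by rw [hz]; exact hn.le)
    rw [hz] at h2
    have hdne : (d n : ℂ) ≠ 0 := by exact_mod_cast hdn.ne'
    have e2 : 2 * π * Complex.I * E n - b n * (E (n + 1) - E n)
        = -(b n * E n) * (Complex.exp ((2 * π * d n : ℝ) * Complex.I) - 1
          - (2 * π * d n : ℝ) * Complex.I) := by
      rw [e1, eTwoPi, hb]; push_cast; field_simp; ring
    rw [e2, norm_mul, norm_neg, norm_mul, hEn, Complex.norm_real, norm_eq_abs,
      abs_of_pos (hbpos n), mul_one]
    calc b n * _ ≤ b n * (2 * π * d n) ^ 2 := mul_le_mul_of_nonneg_left h2 (hbpos n).le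
      _ = _ := by simp only [hb]; field_simp
  have hnull : Tendsto (fun n => 2 * π * Complex.I * E n - b n * (E (n + 1) - E n)) atTop (𝓝 0) := by
    refine squeeze_zero_norm' key ?_
    simpa using h0.const_mul ((2 * π) ^ 2)
  have hces := hnull.cesaro_smul
  have hsum : Tendsto (fun N : ℕ => (∑ n ∈ Finset.range N, (b n : ℂ) * (E (n + 1) - E n)) / N)
      atTop (𝓝 0) := by
    refine squeeze_zero_norm (fun N => ?_) hlim
    rw [norm_div, Complex.norm_natCast]
    exact div_le_div_of_nonneg_right (abel2 N) (Nat.cast_nonneg N)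
  have := (hces.add hsum).const_mul ((2 * π * Complex.I)⁻¹)
  rw [add_zero, mul_zero] at this
  refine this.congr fun N => ?_
  have hpi : (2 * π * Complex.I : ℂ) ≠ 0 := Complex.two_pi_I_ne_zero
  rw [Finset.sum_sub_distrib, ← Finset.mul_sum, Complex.real_smul]
  push_cast
  field_simp
  ring

/-- Van der Corput's difference theorem. -/
lemma meanZero_of_differences (f : ℕ → ℝ)
    (h : ∀ r r' : ℕ, r' < r → MeanZero fun n => f (n + r) - f (n + r')) : MeanZero f := by
  set u : ℕ → ℂ := fun n => eTwoPi (f n) with hu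
  have hun : ∀ n, ‖u n‖ = 1 := fun n => norm_eTwoPi _
  -- correlations
  have hcorr : ∀ r r' : ℕ, Tendsto (fun N : ℕ => (∑ n ∈ Finset.range N,
      u (n + r) * (starRingEnd ℂ) (u (n + r'))) / N) atTop (𝓝 (if r = r' then 1 else 0)) := by
    intro r r'
    rcases lt_trichotomy r' r with hlt | heq | hgt
    · rw [if_neg hlt.ne']
      refine (h r r' hlt).congr fun N => ?_
      simp only [hu, eTwoPi_mul_conj]
    · rw [if_pos heq.symm]
      refine tendsto_const_nhds.congr' ?_
      filter_upwards [eventually_gt_atTop 0] with N hN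
      simp only [heq, Complex.mul_conj, Complex.normSq_eq_norm_sq, hun]
      have : (N : ℂ) ≠ 0 := by exact_mod_cast hN.ne'
      simp [this]
    · rw [if_neg hgt.ne]
      have := (Complex.continuous_conj.tendsto _).comp (h r' r hgt)
      rw [map_zero] at this
      refine this.congr fun N => ?_
      simp only [hu, Function.comp, map_div₀, map_sum, Complex.conj_natCast, ← eTwoPi_mul_conj,
        map_mul, Complex.conj_conj]
      congr 1
      exact Finset.sum_congr rfl fun n _ => mul_comm _ _
  -- smoothing
  have hsmooth : ∀ R : ℕ, ∀ N : ℕ, ‖∑ r ∈ Finset.range R, ∑ n ∈ Finset.range N, u (n + r)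
      - R * ∑ n ∈ Finset.range N, u n‖ ≤ R * (2 * R) := by
    intro R N
    have hr : ∀ r : ℕ, ‖∑ n ∈ Finset.range N, u (n + r) - ∑ n ∈ Finset.range N, u n‖
        ≤ 2 * r := by
      intro r
      induction r with
      | zero => simp
      | succ r ih =>
        have e : ∑ n ∈ Finset.range N, u (n + (r + 1)) = ∑ n ∈ Finset.range N, u (n + r)
            + (u (N + r) - u r) := by
          have h1 := Finset.sum_range_succ (fun n => u (n + r)) N
          have h2 := Finset.sum_range_succ' (fun n => u (n + r)) N
          simp only [zero_add] at h2
          rw [h1] at h2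
          simp only [add_assoc, add_comm 1 r] at h2 ⊢
          linear_combination -h2
        rw [e, add_sub_right_comm]
        refine (norm_add_le _ _).trans ?_
        have := norm_sub_le (u (N + r)) (u r)
        rw [hun, hun] at this
        push_cast
        linarith
    have e : ∑ r ∈ Finset.range R, ∑ n ∈ Finset.range N, u (n + r)
      - R * ∑ n ∈ Finset.range N, u n = ∑ r ∈ Finset.range R,
        (∑ n ∈ Finset.range N, u (n + r) - ∑ n ∈ Finset.range N, u n) := by
      rw [Finset.sum_sub_distrib]; simp
    rw [e]
    refine (norm_sum_le _ _).trans ?_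
    calc _ ≤ ∑ r ∈ Finset.range R, 2 * (R : ℝ) := by
          refine Finset.sum_le_sum fun r hr' => (hr r).trans ?_
          have := (Finset.mem_range.1 hr').le
          gcongr
      _ = _ := by simp
  -- Cauchy-Schwarz
  have hCS : ∀ R : ℕ, Tendsto (fun N : ℕ => (∑ n ∈ Finset.range N,
      ‖∑ r ∈ Finset.range R, u (n + r)‖ ^ 2) / N) atTop (𝓝 R) := by
    intro R
    have h1 : Tendsto (fun N : ℕ => ∑ r ∈ Finset.range R, ∑ r' ∈ Finset.range R,
        (∑ n ∈ Finset.range N, u (n + r) * (starRingEnd ℂ) (u (n + r'))) / N) atTop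
        (𝓝 (∑ r ∈ Finset.range R, ∑ r' ∈ Finset.range R, if r = r' then 1 else 0)) :=
      tendsto_finsetSum _ fun r _ => tendsto_finsetSum _ fun r' _ => hcorr r r'
    have h2 : (∑ r ∈ Finset.range R, ∑ r' ∈ Finset.range R, if r = r' then (1 : ℂ) else 0) = R := by
      rw [Finset.sum_congr rfl fun r hr => Finset.sum_ite_eq _ _ _]
      rw [Finset.sum_congr rfl fun r hr => if_pos hr]
      simp
    rw [h2] at h1
    have h3 := (Complex.continuous_re.tendsto _).comp h1
    rw [Complex.natCast_re] at h3
    refine h3.congr fun N => ?_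
    simp only [Function.comp]
    have e : ∑ r ∈ Finset.range R, ∑ r' ∈ Finset.range R,
        (∑ n ∈ Finset.range N, u (n + r) * (starRingEnd ℂ) (u (n + r'))) / N
        = ((∑ n ∈ Finset.range N, ‖∑ r ∈ Finset.range R, u (n + r)‖ ^ 2) / N : ℝ) := by
      push_cast
      simp only [← Finset.sum_div]
      congr 1
      simp only [← Complex.mul_conj', map_sum, Finset.sum_mul_sum]
      exact (Finset.sum_congr rfl fun r _ => Finset.sum_comm).trans Finset.sum_comm
    rw [e, Complex.ofReal_re]
  rw [MeanZero, tendsto_zero_iff_norm_tendsto_zero]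
  rw [Metric.tendsto_atTop']
  intro ε hε
  obtain ⟨R, hR⟩ := exists_nat_gt (max 1 (8 / ε ^ 2))
  have hR1 : (1 : ℝ) < R := (le_max_left _ _).trans_lt hR
  have hR2 : 8 / ε ^ 2 < R := (le_max_right _ _).trans_lt hR
  have ev1 := (hCS R).eventually (gt_mem_nhds (show (R : ℝ) < 2 * R by linarith))
  have ev2 : ∀ᶠ N : ℕ in atTop, 4 * R / ε < N := tendsto_natCast_atTop_atTop.eventually_gt_atTop _
  obtain ⟨N₀, hN₀⟩ := (ev1.and (ev2.and (eventually_gt_atTop 0))).exists_forall_of_atTop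
  refine ⟨N₀, fun N hN => ?_⟩
  obtain ⟨e1, e2, e3⟩ := hN₀ N hN.le
  have hN0 : (0 : ℝ) < N := by exact_mod_cast e3
  rw [dist_zero_right, norm_norm]
  set S := ‖∑ n ∈ Finset.range N, u n‖ with hS
  set T := ‖∑ n ∈ Finset.range N, ∑ r ∈ Finset.range R, u (n + r)‖ with hT
  have hST : R * S ≤ T + R * (2 * R) := by
    have := hsmooth R N
    rw [Finset.sum_comm] at this
    have h2 := norm_sub_norm_le ((R : ℂ) * ∑ n ∈ Finset.range N, u n)
      (∑ n ∈ Finset.range N, ∑ r ∈ Finset.range R, u (n + r))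
    rw [norm_sub_rev, norm_mul, Complex.norm_natCast] at h2
    linarith
  have hT2 : T ^ 2 < N * (2 * R * N) := by
    have h1 : T ≤ ∑ n ∈ Finset.range N, ‖∑ r ∈ Finset.range R, u (n + r)‖ := norm_sum_le _ _
    have h2 := sq_sum_le_card_mul_sum_sq (s := Finset.range N)
      (f := fun n => ‖∑ r ∈ Finset.range R, u (n + r)‖)
    rw [Finset.card_range] at h2
    rw [div_lt_iff₀ hN0] at e1
    calc T ^ 2 ≤ _ := pow_le_pow_left₀ (norm_nonneg _) h1 2
      _ ≤ _ := h2
      _ < _ := mul_lt_mul_of_pos_left e1 hN0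
  rw [norm_div, Complex.norm_natCast, div_lt_iff₀ hN0]
  rw [div_lt_iff₀ hε] at e2
  rw [div_lt_iff₀ (by positivity)] at hR2
  have hT3 : T < R * (N * ε / 2) := by
    refine lt_of_pow_lt_pow_left₀ 2 (by positivity) (hT2.trans_le ?_)
    have : 0 ≤ (R : ℝ) * N ^ 2 * (R * ε ^ 2 - 8) :=
      mul_nonneg (by positivity) (by linarith)
    nlinarith
  have : R * S < R * (ε * N) := by nlinarith
  exact lt_of_mul_lt_mul_left this (by positivity)

/-- Sequences with an iterated difference slowly decreasing to zero have mean value zero. -/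
lemma meanZero_of_iter_fwdDiff (j : ℕ) : ∀ f : ℕ → ℝ,
    Antitone ((fwdDiff 1)^[j + 1] f) → (∀ n, 0 < (fwdDiff 1)^[j + 1] f n) →
    Tendsto ((fwdDiff 1)^[j + 1] f) atTop (𝓝 0) →
    Tendsto (fun n : ℕ => n * (fwdDiff 1)^[j + 1] f n) atTop atTop → MeanZero f := by
  induction j with
  | zero => exact fun f h1 h2 h3 h4 => meanZero_of_fejer f h1 h2 h3 h4
  | succ j ih =>
    intro f h1 h2 h3 h4
    refine meanZero_of_differences f fun r r' hr => ?_
    set g := (fwdDiff 1)^[j + 1 + 1] f with hg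
    have key : (fwdDiff 1)^[j + 1] (fun n => f (n + r) - f (n + r'))
        = fun n => ∑ i ∈ Finset.Ico r' r, g (n + i) := by
      have e : (fun n => f (n + r) - f (n + r'))
          = ∑ i ∈ Finset.Ico r' r, fun n => fwdDiff 1 f (n + i) := by
        funext n
        rw [Finset.sum_apply]
        exact (Finset.sum_Ico_sub (fun i => f (n + i)) hr.le).symm
      rw [e, fwdDiff_iter_finsetSum]
      funext n
      rw [Finset.sum_apply]
      refine Finset.sum_congr rfl fun i _ => ?_
      rw [fwdDiff_iter_comp_add]; rfl
    have hne : (Finset.Ico r' r).Nonempty := Finset.nonempty_Ico.2 hr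
    refine ih _ ?_ ?_ ?_ ?_ <;> rw [key]
    · exact fun a b hab => Finset.sum_le_sum fun i _ => h1 (by omega)
    · exact fun n => Finset.sum_pos (fun i _ => h2 _) hne
    · have := tendsto_finsetSum (Finset.Ico r' r) fun i _ => h3.comp (tendsto_add_atTop_nat i)
      simpa using this
    · have h5 : Tendsto (fun n : ℕ => ((n + r' : ℕ) : ℝ) * g (n + r') - r' * g (n + r'))
          atTop atTop := by
        have := (h3.comp (tendsto_add_atTop_nat r')).const_mul (-(r' : ℝ))
        refine ((h4.comp (tendsto_add_atTop_nat r')).atTop_add this).congr fun n => ?_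
        simp only [Function.comp]; ring
      refine tendsto_atTop_mono (fun n => ?_) h5
      have : g (n + r') ≤ ∑ i ∈ Finset.Ico r' r, g (n + i) :=
        Finset.single_le_sum (f := fun i => g (n + i)) (fun i _ => (h2 _).le)
          (Finset.left_mem_Ico.2 hr)
      push_cast
      nlinarith [mul_le_mul_of_nonneg_left this (Nat.cast_nonneg (α := ℝ) n)]

lemma fwdDiff_iter_natCast (F : ℝ → ℝ) (j : ℕ) : ∀ n : ℕ,
    (fwdDiff 1)^[j] (fun n : ℕ => F (n + 1)) n = (fwdDiff 1)^[j] F (n + 1) := by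
  induction j with
  | zero => intro n; rfl
  | succ j ih =>
    intro n
    rw [Function.iterate_succ_apply', Function.iterate_succ_apply', fwdDiff, fwdDiff, ih, ih]
    push_cast; rfl

lemma meanZero_rpow {κ θ : ℝ} (hκ : 0 < κ) (hκn : ∀ n : ℕ, κ ≠ n) (hθ : 0 < θ) :
    MeanZero fun n : ℕ => θ * ((n : ℝ) + 1) ^ κ := by
  set j := ⌊κ⌋₊ with hj
  have hj1 : (j : ℝ) < κ := lt_of_le_of_ne (Nat.floor_le hκ.le) (hκn j).symm
  have hj2 : κ < j + 1 := Nat.lt_floor_add_one κ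
  set F : ℝ → ℝ := fun x => θ * rpowCoeff κ 0 * x ^ (κ - (0 : ℕ)) with hF
  have hFe : (fun n : ℕ => θ * ((n : ℝ) + 1) ^ κ) = fun n : ℕ => F (n + 1) := by
    funext n; simp [hF, rpowCoeff_zero]
  have hc : 0 < rpowCoeff κ (j + 1) := rpowCoeff_pos fun i hi =>
    lt_of_le_of_lt (by exact_mod_cast Nat.lt_succ_iff.1 hi) hj1
  have hc2 : rpowCoeff κ (j + 1 + 1) < 0 := by
    rw [rpowCoeff_succ]
    refine mul_neg_of_pos_of_neg hc ?_
    push_cast; linarith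
  set A := θ * rpowCoeff κ (j + 1) with hA
  have hA0 : 0 < A := by positivity
  set β := (j : ℝ) + 1 - κ with hβ
  have hβ0 : 0 < β := by rw [hβ]; linarith
  have hβ1 : β < 1 := by rw [hβ]; linarith
  set D : ℕ → ℝ := (fwdDiff 1)^[j + 1] (fun n : ℕ => F (n + 1)) with hD
  have hbound : ∀ n : ℕ, D n ∈ Set.Icc (A * ((n : ℝ) + j + 2) ^ (-β)) (A * ((n : ℝ) + 1) ^ (-β)) := by
    intro n
    have := fwdDiff_iter_mem_Icc (j + 1) (fun i x => θ * rpowCoeff κ i * x ^ (κ - i)) 1 (n + 1)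
      (A * ((n : ℝ) + j + 2) ^ (-β)) (A * ((n : ℝ) + 1) ^ (-β)) one_pos (by positivity)
      (fun i _ t ht => hasDerivAt_rpowCoeff_mul κ θ i t ht) ?_
    · rw [one_pow, mul_one, mul_one] at this
      rw [hD, fwdDiff_iter_natCast]
      exact this
    · intro t ht
      have e : κ - (j + 1 : ℕ) = -β := by rw [hβ]; push_cast; ring
      simp only [e]
      have ht1 := ht.1
      have ht2 := ht.2
      have ht0 : 0 < t := lt_of_lt_of_le (by positivity) ht1
      push_cast at ht2
      exact ⟨mul_le_mul_of_nonneg_left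
        (rpow_le_rpow_of_nonpos ht0 (by linarith) (by linarith)) hA0.le,
        mul_le_mul_of_nonneg_left
        (rpow_le_rpow_of_nonpos (by positivity) ht1 (by linarith)) hA0.le⟩
  rw [hFe]
  refine meanZero_of_iter_fwdDiff j _ ?_ ?_ ?_ ?_
  · refine antitone_nat_of_succ_le fun n => ?_
    have := fwdDiff_iter_mem_Icc (j + 1 + 1) (fun i x => θ * rpowCoeff κ i * x ^ (κ - i)) 1 (n + 1)
      (θ * rpowCoeff κ (j + 1 + 1) * ((n : ℝ) + 1) ^ (κ - (j + 1 + 1 : ℕ))) 0 one_pos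
      (by positivity) (fun i _ t ht => hasDerivAt_rpowCoeff_mul κ θ i t ht) ?_
    · have h2 := this.2
      rw [zero_mul] at h2
      have e := fwdDiff_iter_natCast F (j + 1 + 1) n
      rw [Function.iterate_succ_apply'] at e
      have : fwdDiff 1 D n ≤ 0 := e.trans_le h2
      rw [fwdDiff] at this
      linarith
    · intro t ht
      have ht0 : (0 : ℝ) < (n : ℝ) + 1 := by positivity
      have htt : 0 < t := ht0.trans_le ht.1
      constructor
      · refine mul_le_mul_of_nonpos_left (rpow_le_rpow_of_nonpos ht0 ht.1 ?_) ?_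
        · push_cast; linarith
        · exact (mul_neg_of_pos_of_neg hθ hc2).le
      · exact mul_nonpos_of_nonpos_of_nonneg (mul_neg_of_pos_of_neg hθ hc2).le (by positivity)
  · exact fun n => lt_of_lt_of_le (by positivity) (hbound n).1
  · have h1 : Tendsto (fun n : ℕ => A * ((n : ℝ) + 1) ^ (-β)) atTop (𝓝 0) := by
      have := ((tendsto_rpow_neg_atTop hβ0).comp
        (tendsto_atTop_add_const_right _ (1 : ℝ) tendsto_natCast_atTop_atTop)).const_mul A
      simpa using this
    exact squeeze_zero (fun n => le_trans (by positivity) (hbound n).1) (fun n => (hbound n).2) h1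
  · have h1 : Tendsto (fun n : ℕ => A * ((j : ℝ) + 3) ^ (-β) * (n : ℝ) ^ (1 - β)) atTop atTop :=
      ((tendsto_rpow_atTop (by linarith)).comp tendsto_natCast_atTop_atTop).const_mul_atTop
        (by positivity)
    refine tendsto_atTop_mono' _ ?_ h1
    filter_upwards [eventually_ge_atTop 1] with n hn
    have hn0 : (0 : ℝ) < n := by exact_mod_cast hn
    have hn1 : (1 : ℝ) ≤ n := by exact_mod_cast hn
    have h2 : (((j : ℝ) + 3) * n) ^ (-β) ≤ ((n : ℝ) + j + 2) ^ (-β) := by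
      refine rpow_le_rpow_of_nonpos (by positivity) ?_ (by linarith)
      nlinarith [Nat.cast_nonneg (α := ℝ) j]
    rw [mul_rpow (by positivity) hn0.le] at h2
    calc A * ((j : ℝ) + 3) ^ (-β) * (n : ℝ) ^ (1 - β)
        = n * (A * (((j : ℝ) + 3) ^ (-β) * (n : ℝ) ^ (-β))) := by
          rw [sub_eq_add_neg, rpow_add hn0, rpow_one]; ring
      _ ≤ n * (A * ((n : ℝ) + j + 2) ^ (-β)) := by gcongr
      _ ≤ n * D n := mul_le_mul_of_nonneg_left (hbound n).1 hn0.le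

/-- A positive proportion of the parts is not divisible by a given `q ≥ 2`. -/
lemma eventually_card_not_dvd {κ : ℝ} (hκ : 0 < κ) (q : ℕ) (hq : 2 ≤ q) :
    ∀ᶠ P : ℕ in atTop, (P : ℝ) / (8 * q) ≤
      ((Finset.range P).filter fun ℓ => ¬ q ∣ psPart κ (ℓ + 1)).card := by
  have hq0 : (0 : ℝ) < q := by positivity
  have hq2 : (2 : ℝ) ≤ q := by exact_mod_cast hq
  by_cases hκn : ∃ k : ℕ, κ = k
  · obtain ⟨k, rfl⟩ := hκn
    filter_upwards [eventually_ge_atTop (2 * q)] with P hP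
    have hsub : (Finset.range (P / q)).image (fun j => q * j) ⊆
        (Finset.range P).filter fun ℓ => ¬ q ∣ psPart k (ℓ + 1) := by
      intro x hx
      obtain ⟨j, hj, rfl⟩ := Finset.mem_image.1 hx
      rw [Finset.mem_range] at hj
      refine Finset.mem_filter.2 ⟨Finset.mem_range.2 ?_, ?_⟩
      · exact (Nat.mul_lt_mul_of_pos_left hj (by omega)).trans_le (Nat.mul_div_le P q)
      · have e : psPart k (q * j + 1) = (q * j + 1) ^ k := by
          rw [psPart, rpow_natCast]; exact_mod_cast Nat.floor_natCast _
        rw [e]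
        intro hdvd
        have h1 : (q * j + 1) ^ k ≡ 1 ^ k [MOD q] :=
          Nat.ModEq.pow k (by simp [Nat.ModEq])
        rw [one_pow] at h1
        have h2 := (Nat.modEq_zero_iff_dvd.2 hdvd).symm.trans h1
        have := (Nat.modEq_zero_iff_dvd.1 h2.symm)
        have := Nat.le_of_dvd one_pos this
        omega
    have hcard := Finset.card_le_card hsub
    rw [Finset.card_image_of_injective _ (fun a b h => Nat.eq_of_mul_eq_mul_left (by omega) h),
      Finset.card_range] at hcard
    refine le_trans ?_ (Nat.cast_le.2 hcard)
    have h1 : (P : ℝ) < q * ((P / q : ℕ) + 1) := by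
      exact_mod_cast Nat.lt_mul_div_succ P (by omega : 0 < q)
    have h2 : (1 : ℝ) ≤ (P / q : ℕ) := by
      exact_mod_cast (Nat.le_div_iff_mul_le (by omega)).2 (by omega)
    rw [div_le_iff₀ (by positivity)]
    nlinarith
  · push Not at hκn
    set f : ℕ → ℝ := fun n => 1 / q * ((n : ℝ) + 1) ^ κ with hf
    have h1 : MeanZero f := meanZero_rpow hκ hκn (by positivity)
    have h2 : MeanZero fun n => 2 * f n := by
      have := meanZero_rpow (θ := 2 * (1 / q)) hκ hκn (by positivity)
      simpa only [hf, mul_assoc] using this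
    set T : ℝ → ℝ := fun x => 2 * sin (2 * π * x) + cos (2 * π * (2 * x)) with hT
    have hTform : ∀ x, T x = 2 * sin (2 * π * x) + 1 - 2 * sin (2 * π * x) ^ 2 := fun x => by
      rw [hT]; simp only; rw [show 2 * π * (2 * x) = 2 * (2 * π * x) by ring, cos_two_mul, cos_sq']
      ring
    have hTlim : Tendsto (fun N : ℕ => (∑ n ∈ Finset.range N, T (f n)) / N) atTop (𝓝 0) := by
      have a1 := ((Complex.continuous_im.tendsto _).comp h1).const_mul 2
      have a2 := (Complex.continuous_re.tendsto _).comp h2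
      have := a1.add a2
      simp only [Complex.zero_im, Complex.zero_re, mul_zero, add_zero] at this
      refine this.congr fun N => ?_
      simp only [Function.comp, eTwoPi, Complex.div_natCast_im, Complex.div_natCast_re,
        Complex.im_sum, Complex.re_sum, Complex.exp_ofReal_mul_I_im, Complex.exp_ofReal_mul_I_re,
        hT, Finset.sum_add_distrib, ← Finset.mul_sum]
      ring
    have hgood : ∀ n : ℕ, q ∣ psPart κ (n + 1) → 1 ≤ T (f n) := by
      rintro n ⟨d, hd⟩
      have b1 := psPart_le κ (n + 1)
      have b2 := lt_psPart_add_one κ (n + 1)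
      rw [hd] at b1 b2
      push_cast at b1 b2
      set δ := f n - d with hδ
      have hfn : f n * q = ((n : ℝ) + 1) ^ κ := by rw [hf]; field_simp
      have hδ0 : 0 ≤ δ := by
        have : 0 ≤ δ * q := by rw [hδ, sub_mul, hfn]; linarith
        exact nonneg_of_mul_nonneg_left this hq0
      have hδ1 : δ ≤ 1 / 2 := by
        have : δ * q < 1 := by rw [hδ, sub_mul, hfn]; linarith
        nlinarith
      have e : 2 * π * f n = 2 * π * δ + d * (2 * π) := by rw [hδ]; ring
      rw [hTform, e, sin_add_nat_mul_two_pi]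
      have hs0 : 0 ≤ sin (2 * π * δ) := sin_nonneg_of_nonneg_of_le_pi
        (by positivity) (by nlinarith [pi_pos])
      have hs1 := sin_le_one (2 * π * δ)
      nlinarith
    have hbad : ∀ x, -3 ≤ T x := fun x => by
      have := neg_one_le_sin (2 * π * x)
      have := neg_one_le_cos (2 * π * (2 * x))
      simp only [hT]; linarith
    filter_upwards [hTlim.eventually (gt_mem_nhds (show (0 : ℝ) < 1 / 2 by norm_num)),
      eventually_gt_atTop 0] with P hP hP0
    have hP0' : (0 : ℝ) < P := by exact_mod_cast hP0
    rw [div_lt_iff₀ hP0'] at hP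
    set B := (Finset.range P).filter fun ℓ => ¬ q ∣ psPart κ (ℓ + 1) with hB
    have hsum : (P : ℝ) - 4 * B.card ≤ ∑ n ∈ Finset.range P, T (f n) := by
      have : ∑ n ∈ Finset.range P, ((1 : ℝ) - if ¬ q ∣ psPart κ (n + 1) then 4 else 0)
          ≤ ∑ n ∈ Finset.range P, T (f n) := by
        refine Finset.sum_le_sum fun n _ => ?_
        split_ifs with h
        · linarith [hgood n h]
        · linarith [hbad (f n)]
      rw [Finset.sum_sub_distrib, ← Finset.sum_filter] at this
      simpa [mul_comm] using this
    rw [div_le_iff₀ (by positivity)]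
    nlinarith [Nat.cast_nonneg (α := ℝ) B.card]

lemma one_div_le_distInt {N : ℤ} {K : ℕ} (hK : 0 < K) (h : ¬ (K : ℤ) ∣ N) :
    1 / (K : ℝ) ≤ distInt ((N : ℝ) / K) := by
  have hK0 : (0 : ℝ) < K := by exact_mod_cast hK
  set z := round ((N : ℝ) / K) with hz
  have h1 : N - z * K ≠ 0 := fun h0 => h ⟨z, by linarith⟩
  have h2 : (1 : ℝ) ≤ |((N - z * K : ℤ) : ℝ)| := by exact_mod_cast Int.one_le_abs h1
  rw [distInt, ← hz, div_le_iff₀ hK0]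
  rw [← abs_of_pos hK0, ← abs_mul, abs_of_pos hK0, sub_mul, div_mul_cancel₀ _ hK0.ne']
  push_cast at h2
  exact h2

lemma div_gcd_dvd_of_dvd_mul {K j a : ℕ} (hK : 0 < K) (h : K ∣ j * a) : K / K.gcd j ∣ a := by
  have hg : 0 < K.gcd j := Nat.gcd_pos_of_pos_left _ hK
  have hc : Nat.Coprime (K / K.gcd j) (j / K.gcd j) := Nat.coprime_div_gcd_div_gcd hg
  refine hc.dvd_of_dvd_mul_left ?_
  rw [← Nat.mul_div_right_comm (Nat.gcd_dvd_right K j)]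
  exact Nat.div_dvd_div (Nat.gcd_dvd_left K j) h

/-- Minor and major arcs together: the mean square distance of `α ⌊ℓ^κ⌋` to the integers. -/
lemma exists_sum_distInt_sq {κ : ℝ} (hκ : 0 < κ) : ∃ c > 0, ∀ᶠ P : ℕ in atTop, ∀ α : ℝ,
    0 ≤ α → α ≤ 1 / 2 → c * (P * min ((α * (P : ℝ) ^ κ) ^ 2) 1) ≤
      ∑ ℓ ∈ Finset.range (3 * P), distInt (α * psPart κ (ℓ + 1)) ^ 2 := by
  obtain ⟨C₀, hC₀, c, hc, c', hc', hc12, hsmall⟩ := exists_sum_distInt_sq_of_small hκ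
  set Q := ⌈1 / c⌉₊ with hQ
  have hQ1 : 1 ≤ Q := Nat.one_le_ceil_iff.2 (by positivity)
  have hQ0 : (0 : ℝ) < Q := by exact_mod_cast hQ1
  have hQ1' : (1 : ℝ) ≤ Q := by exact_mod_cast hQ1
  have hQc : 1 / c ≤ Q := Nat.le_ceil _
  obtain ⟨ε, hε0, hε1, hε⟩ : ∃ ε > 0, ε ≤ 1 ∧ C₀ * ε ^ κ ≤ 1 / (2 * Q) := by
    refine ⟨min 1 ((1 / (2 * Q * C₀)) ^ (1 / κ)), by positivity, min_le_left _ _, ?_⟩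
    have : (min 1 ((1 / (2 * Q * C₀)) ^ (1 / κ))) ^ κ ≤ 1 / (2 * Q * C₀) := by
      refine (rpow_le_rpow (by positivity) (min_le_right _ _) hκ.le).trans ?_
      rw [← rpow_mul (by positivity), one_div_mul_cancel hκ.ne', rpow_one]
    calc _ ≤ C₀ * (1 / (2 * Q * C₀)) := by gcongr
      _ = _ := by field_simp
  set b₁ := ε / 4 * ((ε / 4) ^ κ / 2) ^ 2 with hb₁
  set b := min b₁ (min (c' / Q ^ 2) (ε / (64 * Q ^ 3))) with hb
  have hb0 : 0 < b := by positivity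
  have hbb₁ : b ≤ b₁ := min_le_left _ _
  have hbc : b ≤ c' / Q ^ 2 := (min_le_right _ _).trans (min_le_left _ _)
  have hbε : b ≤ ε / (64 * Q ^ 3) := (min_le_right _ _).trans (min_le_right _ _)
  have hmt : Tendsto (fun P : ℕ => ⌊ε * P⌋₊) atTop atTop :=
    tendsto_nat_floor_atTop.comp (tendsto_natCast_atTop_atTop.const_mul_atTop hε0)
  have ev : ∀ᶠ P : ℕ in atTop, ∀ q ∈ Finset.Icc 2 Q, (P : ℝ) / (8 * q) ≤
      ((Finset.range P).filter fun ℓ => ¬ q ∣ psPart κ (ℓ + 1)).card :=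
    (eventually_all_finset _).2 fun q hq =>
      eventually_card_not_dvd hκ q (Finset.mem_Icc.1 hq).1
  have ev2 : ∀ᶠ P : ℕ in atTop, C₀ * (P : ℝ) ^ (-κ) < c := by
    have := ((tendsto_rpow_neg_atTop hκ).comp tendsto_natCast_atTop_atTop).const_mul C₀
    rw [mul_zero] at this
    exact this.eventually (gt_mem_nhds hc)
  refine ⟨b, hb0, ?_⟩
  filter_upwards [hmt.eventually ev, ev2, eventually_ge_atTop 1,
    tendsto_natCast_atTop_atTop.eventually_ge_atTop (2 / ε)] with P hcard hPc hP1 hPε α hα0 hα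
  have hP0 : (0 : ℝ) < P := by exact_mod_cast hP1
  set m := ⌊ε * P⌋₊ with hm
  have hεP : 2 ≤ ε * P := by rw [div_le_iff₀ hε0] at hPε; linarith
  have hmP : (m : ℝ) ≤ ε * P := Nat.floor_le (by positivity)
  have hmP2 : ε * P / 2 ≤ m := by
    have := Nat.lt_floor_add_one (ε * P)
    linarith
  have hm3 : m ≤ 3 * P := by
    have : (m : ℝ) ≤ 3 * P := by nlinarith
    exact_mod_cast this
  set D : ℕ → ℝ := fun ℓ => distInt (α * psPart κ (ℓ + 1)) ^ 2 with hD
  have hD0 : ∀ ℓ, 0 ≤ D ℓ := fun ℓ => sq_nonneg _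
  have hPκ : (P : ℝ) ^ (-κ) * (P : ℝ) ^ κ = 1 := by rw [← rpow_add hP0]; simp
  -- parts below the cutoff are small
  have hsm : ∀ ℓ < m, C₀ * (P : ℝ) ^ (-κ) * psPart κ (ℓ + 1) ≤ 1 / (2 * Q) := by
    intro ℓ hℓ
    refine le_trans ?_ hε
    have h1 := psPart_le κ (ℓ + 1)
    have h2 : ((ℓ + 1 : ℕ) : ℝ) ≤ ε * P := le_trans (by exact_mod_cast hℓ) hmP
    calc C₀ * (P : ℝ) ^ (-κ) * psPart κ (ℓ + 1) ≤ C₀ * (P : ℝ) ^ (-κ) * (ε * P) ^ κ := by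
          gcongr
          exact h1.trans (rpow_le_rpow (by positivity) h2 hκ.le)
      _ = C₀ * ε ^ κ * ((P : ℝ) ^ (-κ) * (P : ℝ) ^ κ) := by
          rw [mul_rpow hε0.le hP0.le]; ring
      _ = _ := by rw [hPκ, mul_one]
  have of_one : b * P ≤ ∑ ℓ ∈ Finset.range (3 * P), D ℓ →
      b * (P * min ((α * (P : ℝ) ^ κ) ^ 2) 1) ≤ ∑ ℓ ∈ Finset.range (3 * P), D ℓ := by
    intro h
    refine le_trans ?_ h
    refine mul_le_mul_of_nonneg_left ?_ hb0.le
    exact mul_le_of_le_one_right hP0.le (min_le_right _ _)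
  have sub_sum : ∀ s ⊆ Finset.range m, ∑ ℓ ∈ s, D ℓ ≤ ∑ ℓ ∈ Finset.range (3 * P), D ℓ :=
    fun s hs => Finset.sum_le_sum_of_subset_of_nonneg
      (hs.trans (Finset.range_mono hm3)) fun _ _ _ => hD0 _
  rcases lt_or_ge α (C₀ * (P : ℝ) ^ (-κ)) with hlt | hge
  · refine le_trans ?_ (sub_sum (Finset.Ico (m / 2) m) fun x hx =>
      Finset.mem_range.2 (Finset.mem_Ico.1 hx).2)
    have hterm : ∀ ℓ ∈ Finset.Ico (m / 2) m, (α * ((ε / 4 * P) ^ κ / 2)) ^ 2 ≤ D ℓ := by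
      intro ℓ hℓ
      obtain ⟨hl1, hl2⟩ := Finset.mem_Ico.1 hℓ
      have h1 := hsm ℓ hl2
      have h2 : α * psPart κ (ℓ + 1) ≤ 1 / 2 := by
        calc α * psPart κ (ℓ + 1) ≤ C₀ * (P : ℝ) ^ (-κ) * psPart κ (ℓ + 1) := by gcongr
          _ ≤ 1 / (2 * Q) := h1
          _ ≤ 1 / 2 := by
            rw [div_le_div_iff₀ (by positivity) (by norm_num)]; linarith
      have h3 : 0 ≤ α * psPart κ (ℓ + 1) := by positivity
      simp only [hD]
      rw [distInt_eq_abs (by rwa [abs_of_nonneg h3]), abs_of_nonneg h3]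
      refine pow_le_pow_left₀ (by positivity) ?_ 2
      refine mul_le_mul_of_nonneg_left (le_trans ?_ (rpow_div_two_le_psPart hκ ℓ)) hα0
      have h4 : ε / 4 * P ≤ (ℓ : ℝ) + 1 := by
        have : m ≤ 2 * (ℓ + 1) := by omega
        have : (m : ℝ) ≤ 2 * (ℓ + 1) := by exact_mod_cast this
        linarith
      gcongr
    have hsum := Finset.card_nsmul_le_sum _ _ _ hterm
    refine le_trans ?_ hsum
    rw [Nat.card_Ico, nsmul_eq_mul]
    have h5 : ε / 4 * P ≤ ((m - m / 2 : ℕ) : ℝ) := by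
      have : m ≤ 2 * (m - m / 2) := by omega
      have : (m : ℝ) ≤ 2 * (m - m / 2 : ℕ) := by exact_mod_cast this
      linarith
    calc b * (P * min ((α * (P : ℝ) ^ κ) ^ 2) 1) ≤ b₁ * (P * (α * (P : ℝ) ^ κ) ^ 2) := by
          gcongr
          exact min_le_left _ _
      _ = ε / 4 * P * (α * ((ε / 4 * P) ^ κ / 2)) ^ 2 := by
          rw [mul_rpow (by positivity) hP0.le, hb₁]; ring
      _ ≤ _ := by gcongr
  refine of_one ?_
  rcases le_or_gt α c with hαc | hcα
  · refine le_trans ?_ (hsmall P hP1 α hge hαc)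
    gcongr
    exact hbc.trans (div_le_self hc'.le (by nlinarith))
  obtain ⟨j, k, hk0, hkQ, hjk⟩ := exists_int_int_abs_mul_sub_le α (n := Q) (by omega)
  lift k to ℕ using hk0.le
  have hk0' : 0 < k := by exact_mod_cast hk0
  have hkQ' : k ≤ Q := by exact_mod_cast hkQ
  have hkR : (0 : ℝ) < k := by exact_mod_cast hk0'
  have hkQR : (k : ℝ) ≤ Q := by exact_mod_cast hkQ'
  push_cast at hjk
  set β := (k : ℝ) * α - j with hβ
  rcases lt_or_ge |β| (C₀ * (P : ℝ) ^ (-κ)) with hβlt | hβge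
  · set q := k / k.gcd j.natAbs with hq
    have hg : 0 < k.gcd j.natAbs := Nat.gcd_pos_of_pos_left _ hk0'
    have hq0 : 0 < q := Nat.div_pos (Nat.gcd_le_left _ hk0') hg
    have hqk : q ≤ k := Nat.div_le_self _ _
    have hq1 : q ≠ 1 := by
      intro h1
      have h2 : k = k.gcd j.natAbs := by
        have := Nat.div_mul_cancel (Nat.gcd_dvd_left k j.natAbs)
        rw [← hq, h1, one_mul] at this
        exact this.symm
      have h3 : k ∣ j.natAbs := h2 ▸ Nat.gcd_dvd_right k j.natAbs
      obtain ⟨z, hz⟩ := Int.natCast_dvd.2 h3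
      have hβz : β = k * (α - z) := by rw [hβ, hz]; push_cast; ring
      have h4 : |α - z| < c := by
        have : |α - z| ≤ |β| := by
          rw [hβz, abs_mul, Nat.abs_cast]
          exact le_mul_of_one_le_left (abs_nonneg _) (by exact_mod_cast hk0')
        linarith
      rcases le_or_gt z 0 with hz0 | hz0
      · have : (z : ℝ) ≤ 0 := by exact_mod_cast hz0
        have := le_abs_self (α - z)
        linarith
      · have : (1 : ℝ) ≤ z := by exact_mod_cast hz0
        have := neg_abs_le (α - z)
        linarith
    have hcq := hcard q (Finset.mem_Icc.2 ⟨by omega, hqk.trans hkQ'⟩)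
    have hterm : ∀ ℓ ∈ (Finset.range m).filter fun ℓ => ¬ q ∣ psPart κ (ℓ + 1),
        (1 / (2 * Q : ℝ)) ^ 2 ≤ D ℓ := by
      intro ℓ hℓ
      obtain ⟨hl1, hl2⟩ := Finset.mem_filter.1 hℓ
      refine pow_le_pow_left₀ (by positivity) ?_ 2
      set a := psPart κ (ℓ + 1) with ha
      have hnd : ¬ (k : ℤ) ∣ j * a := by
        intro hd
        refine hl2 (div_gcd_dvd_of_dvd_mul hk0' ?_)
        have := Int.natAbs_dvd_natAbs.2 hd
        rwa [Int.natAbs_mul, Int.natAbs_natCast, Int.natAbs_natCast] at this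
      have h1 := one_div_le_distInt hk0' hnd
      have e : ((j * a : ℤ) : ℝ) / k = α * a + -(β * a / k) := by
        rw [hβ]; push_cast; field_simp; ring
      rw [e] at h1
      have h2 := h1.trans (distInt_add_le _ _)
      have h3 : |-(β * a / k)| ≤ 1 / (2 * k) := by
        rw [abs_neg, abs_div, abs_mul, Nat.abs_cast, Nat.abs_cast, ← div_div]
        gcongr
        have hs := hsm ℓ (Finset.mem_range.1 hl1)
        calc |β| * a ≤ C₀ * (P : ℝ) ^ (-κ) * a := by gcongr
          _ ≤ 1 / (2 * Q) := hs
          _ ≤ 1 / 2 := by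
            rw [div_le_div_iff₀ (by positivity) (by norm_num)]; linarith
      have h4 : 1 / (2 * (Q : ℝ)) ≤ 1 / (2 * k) := by gcongr
      have h5 : 1 / (k : ℝ) = 1 / (2 * k) + 1 / (2 * k) := by field_simp; norm_num
      linarith
    have hsum := Finset.card_nsmul_le_sum _ _ _ hterm
    refine le_trans ?_ (hsum.trans (sub_sum _ (Finset.filter_subset _ _)))
    rw [nsmul_eq_mul]
    have hqR : (0 : ℝ) < q := by exact_mod_cast hq0
    have hqQ : (q : ℝ) ≤ Q := by exact_mod_cast hqk.trans hkQ'
    calc b * P ≤ ε / (64 * Q ^ 3) * P := by gcongr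
      _ = (ε * P / 2) / (8 * Q) * (1 / (2 * Q : ℝ)) ^ 2 := by field_simp; norm_num
      _ ≤ m / (8 * q) * (1 / (2 * Q : ℝ)) ^ 2 := by gcongr
      _ ≤ _ := by gcongr
  · have hβc : |β| ≤ c := by
      refine hjk.trans ?_
      rw [div_le_iff₀ hc] at hQc
      rw [div_le_iff₀ (by positivity)]
      nlinarith
    have h1 := hsmall P hP1 |β| hβge hβc
    have h2 : ∀ ℓ ∈ Finset.range (3 * P), distInt (|β| * psPart κ (ℓ + 1)) ^ 2
        ≤ Q ^ 2 * D ℓ := by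
      intro ℓ _
      simp only [hD]
      rw [← mul_pow]
      refine pow_le_pow_left₀ (distInt_nonneg _) ?_ 2
      set a := psPart κ (ℓ + 1) with ha
      have e : distInt (|β| * a) = distInt (β * a) := by
        rcases abs_choice β with h | h <;> rw [h]
        rw [neg_mul, distInt_neg]
      have e2 : β * a = k * (α * a) - ((j * a : ℤ) : ℝ) := by rw [hβ]; push_cast; ring
      rw [e, e2, distInt_sub_intCast_mul]
      refine (distInt_natCast_mul_le _ _).trans ?_
      gcongr
      exact distInt_nonneg _
    have h3 := h1.trans (Finset.sum_le_sum h2)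
    rw [← Finset.mul_sum] at h3
    calc b * P ≤ c' / Q ^ 2 * P := by gcongr
      _ = c' * P / Q ^ 2 := by ring
      _ ≤ _ := by rw [div_le_iff₀ (by positivity)]; linarith

lemma isOpen_re_pos : IsOpen {z : ℂ | 0 < z.re} :=
  isOpen_lt continuous_const Complex.continuous_re

lemma isOpen_lt_re (c : ℝ) : IsOpen {z : ℂ | c < z.re} :=
  isOpen_lt continuous_const Complex.continuous_re

lemma hasDerivAt_of_re_pos {F : ℂ → ℂ} (hF : DifferentiableOn ℂ F {z | 0 < z.re}) {z : ℂ}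
    (hz : 0 < z.re) : HasDerivAt F (deriv F z) z :=
  (hF.differentiableAt (isOpen_re_pos.mem_nhds hz)).hasDerivAt

lemma hasDerivAt_real_of_ofReal_eq {F : ℂ → ℂ} {g : ℝ → ℝ}
    (hF : DifferentiableOn ℂ F {z | 0 < z.re}) (h : ∀ x : ℝ, 0 < x → F x = g x) {x : ℝ}
    (hx : 0 < x) : HasDerivAt g (deriv g x) x ∧ deriv F x = deriv g x := by
  have h1 : HasDerivAt (fun t : ℝ => F t) (deriv F x) x :=
    (hasDerivAt_of_re_pos hF (by simpa using hx)).comp_ofReal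
  have h2 : HasDerivAt (fun t : ℝ => (g t : ℂ)) (deriv F x) x :=
    h1.congr_of_eventuallyEq (by
      filter_upwards [lt_mem_nhds hx] with t ht
      exact (h t ht).symm)
  have h3 : HasDerivAt g (deriv F x).re x := by
    simpa [Function.comp_def] using (Complex.reCLM.hasFDerivAt.comp_hasDerivAt x h2)
  have h4 : HasDerivAt (fun _ : ℝ => (0 : ℝ)) (deriv F x).im x := by
    simpa [Function.comp_def] using (Complex.imCLM.hasFDerivAt.comp_hasDerivAt x h2)
  have h5 : (deriv F x).im = 0 := h4.unique (hasDerivAt_const x 0)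
  refine ⟨h3.differentiableAt.hasDerivAt, ?_⟩
  rw [h3.deriv]
  exact Complex.ext (by simp) (by simp [h5])

lemma norm_deriv_le_of_re_bound {F : ℂ → ℂ} {u s : ℝ} (hs : 0 ≤ s)
    (hF : DifferentiableOn ℂ F {z | 0 < z.re})
    (hb : ∀ z : ℂ, 0 < z.re → ‖F z‖ ≤ u * z.re ^ (-s)) {z : ℂ} (hz : 0 < z.re) :
    ‖deriv F z‖ ≤ (2 ^ (s + 1) * u) * z.re ^ (-(s + 1)) := by
  have hu : 0 ≤ u := by
    have := (norm_nonneg _).trans (hb 1 (by simp))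
    simpa using this
  have hre : ∀ w ∈ Metric.closedBall z (z.re / 2), z.re / 2 ≤ w.re := by
    intro w hw
    have h1 := (Complex.abs_re_le_norm (w - z)).trans (mem_closedBall_iff_norm.1 hw)
    rw [Complex.sub_re] at h1
    linarith [(abs_le.1 h1).1]
  have hd : DiffContOnCl ℂ F (Metric.ball z (z.re / 2)) := by
    apply DifferentiableOn.diffContOnCl
    apply hF.mono
    intro w hw
    have := hre w (Metric.closure_ball_subset_closedBall hw)
    simp only [Set.mem_ofPred_eq]
    linarith
  have := Complex.norm_deriv_le_of_forall_mem_sphere_norm_le (C := u * (z.re / 2) ^ (-s))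
    (by linarith) hd (fun w hw => by
      have h1 := hre w (Metric.sphere_subset_closedBall hw)
      refine (hb w (by linarith)).trans ?_
      gcongr 1
      exact Real.rpow_le_rpow_of_nonpos (by linarith) h1 (by linarith))
  refine this.trans (le_of_eq ?_)
  have e : u * (z.re / 2) ^ (-s) / (z.re / 2) = u * (z.re / 2) ^ (-(s + 1)) := by
    rw [mul_div_assoc, neg_add, ← sub_eq_add_neg, Real.rpow_sub_one (by linarith)]
  rw [e, Real.div_rpow hz.le (by norm_num), Real.rpow_neg (by norm_num : (0:ℝ) ≤ 2)]
  field_simp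

/-- Termwise differentiation of a series of holomorphic functions on the right half plane whose
terms are dominated by a power of the real part. -/
lemma tsum_re_bound {F : ℕ → ℂ → ℂ} {u : ℕ → ℝ} {s : ℝ} (hs : 0 ≤ s) (hu : Summable u)
    (hF : ∀ i, DifferentiableOn ℂ (F i) {z | 0 < z.re})
    (hb : ∀ i, ∀ z : ℂ, 0 < z.re → ‖F i z‖ ≤ u i * z.re ^ (-s)) :
    DifferentiableOn ℂ (fun z => ∑' i, F i z) {z | 0 < z.re} ∧
      (∀ z : ℂ, 0 < z.re → Summable fun i => F i z) ∧
      (∀ z : ℂ, 0 < z.re → ‖∑' i, F i z‖ ≤ (∑' i, u i) * z.re ^ (-s)) ∧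
      (∀ z : ℂ, 0 < z.re →
        HasSum (fun i => deriv (F i) z) (deriv (fun w => ∑' i, F i w) z)) := by
  have hu0 : ∀ i, 0 ≤ u i := fun i => by
    have := (norm_nonneg _).trans (hb i 1 (by simp))
    simpa using this
  have hloc : ∀ z : ℂ, 0 < z.re → ∀ i, ∀ w ∈ {w : ℂ | z.re / 2 < w.re},
      ‖F i w‖ ≤ u i * (z.re / 2) ^ (-s) := by
    intro z hz i w hw
    simp only [Set.mem_ofPred_eq] at hw
    refine (hb i w (by linarith)).trans ?_
    have := hu0 i
    gcongr 1
    exact Real.rpow_le_rpow_of_nonpos (by linarith) hw.le (by linarith)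
  have hsub : ∀ z : ℂ, 0 < z.re → {w : ℂ | z.re / 2 < w.re} ⊆ {w | 0 < w.re} := by
    intro z hz w hw
    simp only [Set.mem_ofPred_eq] at hw ⊢
    linarith
  refine ⟨?_, ?_, ?_, ?_⟩
  · intro z hz
    have hz' : 0 < z.re := hz
    have h1 := Complex.differentiableOn_tsum_of_summable_norm (hu.mul_right ((z.re / 2) ^ (-s)))
      (fun i => (hF i).mono (hsub z hz)) (isOpen_lt_re _) (hloc z hz)
    exact (h1.differentiableAt ((isOpen_lt_re (z.re / 2)).mem_nhds (by
      simp only [Set.mem_ofPred_eq]; linarith))).differentiableWithinAt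
  · intro z hz
    exact Summable.of_norm_bounded (hu.mul_right _) (fun i => hb i z hz)
  · intro z hz
    rw [← tsum_mul_right]
    exact tsum_of_norm_bounded (hu.mul_right _).hasSum (fun i => hb i z hz)
  · intro z hz
    exact Complex.hasSum_deriv_of_summable_norm (hu.mul_right ((z.re / 2) ^ (-s)))
      (fun i => (hF i).mono (hsub z hz)) (isOpen_lt_re _) (hloc z hz)
      (by simp only [Set.mem_ofPred_eq]; linarith)

lemma exp_neg_le_rpow {s t : ℝ} (hs : 0 < s) (ht : 0 < t) :
    Real.exp (-t) ≤ s ^ s * t ^ (-s) := by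
  have h1 : t / s ≤ Real.exp (t / s) := by linarith [Real.add_one_le_exp (t / s)]
  have h2 := Real.rpow_le_rpow (by positivity) h1 hs.le
  rw [← Real.exp_mul, div_mul_cancel₀ _ hs.ne', Real.div_rpow ht.le hs.le,
    div_le_iff₀ (by positivity)] at h2
  rw [Real.exp_neg, Real.rpow_neg ht.le, ← div_eq_mul_inv, inv_le_comm₀ (by positivity)
    (by positivity), inv_div, div_le_iff₀ (by positivity)]
  exact h2

/-- `-log (1 - e^{-w})`. -/
noncomputable def negLog (w : ℂ) : ℂ := -Complex.log (1 - Complex.exp (-w))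

lemma norm_exp_neg_lt_one {w : ℂ} (hw : 0 < w.re) : ‖Complex.exp (-w)‖ < 1 := by
  rw [Complex.norm_exp]
  simpa using hw

lemma differentiableOn_negLog : DifferentiableOn ℂ negLog {z | 0 < z.re} := by
  intro w hw
  have h1 : (1 - Complex.exp (-w)) ∈ Complex.slitPlane := by
    have h2 := (Complex.re_le_norm (Complex.exp (-w))).trans_lt (norm_exp_neg_lt_one hw)
    left
    simpa using h2
  apply DifferentiableAt.differentiableWithinAt
  unfold negLog
  have h3 : DifferentiableAt ℂ (fun w : ℂ => 1 - Complex.exp (-w)) w := by fun_prop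
  exact (h3.clog h1).neg

lemma exp_negLog {w : ℂ} (hw : 0 < w.re) :
    Complex.exp (negLog w) * (1 - Complex.exp (-w)) = 1 := by
  have h : 1 - Complex.exp (-w) ≠ 0 := by
    intro h
    have h2 := norm_exp_neg_lt_one hw
    rw [← sub_eq_zero.1 h] at h2
    simp at h2
  rw [negLog, Complex.exp_neg, Complex.exp_log h, inv_mul_cancel₀ h]

lemma negLog_ofReal {x : ℝ} (hx : 0 < x) :
    negLog x = ((-Real.log (1 - Real.exp (-x)) : ℝ) : ℂ) := by
  have : 0 ≤ 1 - Real.exp (-x) := by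
    have := Real.exp_le_one_iff.2 (neg_nonpos.2 hx.le)
    linarith
  rw [negLog, Complex.ofReal_neg, Complex.ofReal_log this]
  push_cast
  rfl

lemma norm_negLog_le {s : ℝ} (hs : 0 < s) :
    ∃ C > 0, ∀ w : ℂ, 0 < w.re → ‖negLog w‖ ≤ C * w.re ^ (-s) := by
  have hsum : Summable fun k : ℕ => (k : ℝ) ^ (-(1 + s)) := by
    rw [Real.summable_nat_rpow]
    linarith
  have hnn : 0 ≤ ∑' k : ℕ, (k : ℝ) ^ (-(1 + s)) := tsum_nonneg fun k => by positivity
  refine ⟨s ^ s * (∑' k : ℕ, (k : ℝ) ^ (-(1 + s)) + 1), by positivity, fun w hw => ?_⟩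
  have h1 := Complex.hasSum_taylorSeries_neg_log (norm_exp_neg_lt_one hw)
  have h2 : ‖negLog w‖ ≤ ∑' k : ℕ, (s ^ s * w.re ^ (-s)) * (k : ℝ) ^ (-(1 + s)) := by
    rw [negLog, ← h1.tsum_eq]
    refine tsum_of_norm_bounded (hsum.mul_left _).hasSum (fun k => ?_)
    rcases Nat.eq_zero_or_pos k with rfl | hk
    · simp
      positivity
    have hk' : (0 : ℝ) < k := by exact_mod_cast hk
    rw [norm_div, norm_pow, Complex.norm_exp, Complex.norm_natCast, ← Real.exp_nat_mul,
      div_le_iff₀ hk']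
    have h3 := exp_neg_le_rpow hs (mul_pos hk' hw)
    have e : (k : ℝ) * (-w).re = -(k * w.re) := by simp
    rw [e]
    refine h3.trans (le_of_eq ?_)
    rw [Real.mul_rpow hk'.le hw.le, neg_add, Real.rpow_add hk', Real.rpow_neg_one]
    field_simp
  rw [tsum_mul_left] at h2
  refine h2.trans ?_
  have : 0 ≤ s ^ s * w.re ^ (-s) := by positivity
  nlinarith

/-- The moments `∑_{j ≤ m} j^k e^{-jx}`. -/
noncomputable def expMoment (m k : ℕ) (x : ℝ) : ℝ :=
  ∑ j ∈ Finset.range (m + 1), (j : ℝ) ^ k * Real.exp (-(j * x))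

lemma hasDerivAt_expMoment (m k : ℕ) (x : ℝ) :
    HasDerivAt (expMoment m k) (-expMoment m (k + 1) x) x := by
  unfold expMoment
  rw [← Finset.sum_neg_distrib]
  apply HasDerivAt.fun_sum
  intro j _
  have h := (((hasDerivAt_id x).const_mul (j : ℝ)).neg.exp).const_mul ((j : ℝ) ^ k)
  refine h.congr_deriv ?_
  simp
  ring

lemma expMoment_zero_pos (m : ℕ) (x : ℝ) : 0 < expMoment m 0 x := by
  unfold expMoment
  apply Finset.sum_pos
  · intro j _
    positivity
  · simp

lemma expMoment_nonneg (m k : ℕ) (x : ℝ) : 0 ≤ expMoment m k x := by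
  unfold expMoment
  positivity

lemma expMoment_zero_le (m : ℕ) {x : ℝ} (hx : 0 ≤ x) : expMoment m 0 x ≤ m + 1 := by
  unfold expMoment
  calc _ ≤ ∑ j ∈ Finset.range (m + 1), (1 : ℝ) := by
        apply Finset.sum_le_sum
        intro j _
        rw [pow_zero, one_mul, Real.exp_le_one_iff, neg_nonpos]
        positivity
    _ = _ := by simp

lemma exp_neg_le_expMoment {m : ℕ} (hm : 1 ≤ m) (k : ℕ) (x : ℝ) :
    Real.exp (-x) ≤ expMoment m k x := by
  unfold expMoment
  have h := Finset.single_le_sum (f := fun j : ℕ => (j : ℝ) ^ k * Real.exp (-(j * x)))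
    (s := Finset.range (m + 1)) (fun j _ => by positivity) (a := 1) (by simp; omega)
  simpa using h

lemma exp_neg_le_expMoment_det {m : ℕ} (hm : 1 ≤ m) (x : ℝ) :
    Real.exp (-x) ≤ expMoment m 2 x * expMoment m 0 x - expMoment m 1 x ^ 2 := by
  have h0 : expMoment m 0 x = ∑ j ∈ Finset.range m, Real.exp (-((j + 1 : ℕ) * x)) + 1 := by
    simp [expMoment, Finset.sum_range_succ']
  have h1 : expMoment m 1 x
      = ∑ j ∈ Finset.range m, ((j + 1 : ℕ) : ℝ) * Real.exp (-((j + 1 : ℕ) * x)) := by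
    simp [expMoment, Finset.sum_range_succ']
  have h2 : expMoment m 2 x
      = ∑ j ∈ Finset.range m, ((j + 1 : ℕ) : ℝ) ^ 2 * Real.exp (-((j + 1 : ℕ) * x)) := by
    simp [expMoment, Finset.sum_range_succ']
  have hcs : expMoment m 1 x ^ 2
      ≤ expMoment m 2 x * ∑ j ∈ Finset.range m, Real.exp (-((j + 1 : ℕ) * x)) := by
    rw [h1, h2]
    apply Finset.sum_sq_le_sum_mul_sum_of_sq_le_mul
    · intro j _
      positivity
    · intro j _
      positivity
    · intro j _
      exact le_of_eq (by ring)
  have := exp_neg_le_expMoment hm 2 x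
  rw [h0]
  nlinarith

lemma hasDerivAt_log_expMoment (m : ℕ) (x : ℝ) :
    HasDerivAt (fun x => Real.log (expMoment m 0 x)) (-(expMoment m 1 x / expMoment m 0 x)) x := by
  refine ((hasDerivAt_expMoment m 0 x).log (expMoment_zero_pos m x).ne').congr_deriv ?_
  ring

lemma hasDerivAt_expMoment_div (m : ℕ) (x : ℝ) :
    HasDerivAt (fun x => -(expMoment m 1 x / expMoment m 0 x))
      ((expMoment m 2 x * expMoment m 0 x - expMoment m 1 x ^ 2) / expMoment m 0 x ^ 2) x := by
  have h := ((hasDerivAt_expMoment m 1 x).div (hasDerivAt_expMoment m 0 x)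
    (expMoment_zero_pos m x).ne').neg
  refine h.congr_deriv ?_
  rw [← neg_div]
  congr 1
  ring

lemma expMoment_zero_mul (m : ℕ) (x : ℝ) :
    expMoment m 0 x * (1 - Real.exp (-x)) = 1 - Real.exp (-((m + 1) * x)) := by
  have h := geom_sum_mul (Real.exp (-x)) (m + 1)
  have e : expMoment m 0 x = ∑ i ∈ Finset.range (m + 1), Real.exp (-x) ^ i := by
    unfold expMoment
    refine Finset.sum_congr rfl fun j _ => ?_
    rw [← Real.exp_nat_mul]
    simp
  rw [e]
  rw [← Real.exp_nat_mul] at h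
  push_cast at h
  rw [mul_neg] at h
  linarith

/-- The logarithm of `1 + q + ⋯ + q^m` at `q = e^{-za}`, with `a` the part of index `ℓ + 1`. -/
noncomputable def psTerm (κ : ℝ) (m ℓ : ℕ) (z : ℂ) : ℂ :=
  negLog (psPart κ (ℓ + 1) * z) - negLog ((m + 1) * (psPart κ (ℓ + 1) * z))

/-- The logarithm of the generating function of `p_{κ,m}` at `q = e^{-z}`. -/
noncomputable def psLog (κ : ℝ) (m : ℕ) (z : ℂ) : ℂ := ∑' ℓ, psTerm κ m ℓ z

lemma psPart_pos {κ : ℝ} (hκ : 0 < κ) (ℓ : ℕ) : (0 : ℝ) < psPart κ (ℓ + 1) := by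
  exact_mod_cast one_le_psPart hκ ℓ

lemma re_natCast_mul (a : ℕ) (z : ℂ) : ((a : ℂ) * z).re = a * z.re := by simp

lemma re_natCast_add_one_mul (m : ℕ) (z : ℂ) : (((m : ℂ) + 1) * z).re = (m + 1) * z.re := by
  have := re_natCast_mul (m + 1) z
  push_cast at this
  exact this

lemma differentiableOn_negLog_mul (a : ℕ) (ha : (0 : ℝ) < a) :
    DifferentiableOn ℂ (fun z => negLog (a * z)) {z | 0 < z.re} := by
  refine differentiableOn_negLog.comp (by fun_prop) fun z hz => ?_
  simp only [Set.mem_ofPred_eq] at hz ⊢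
  rw [re_natCast_mul]
  positivity

lemma summable_psPart {κ s : ℝ} (hκ : 0 < κ) (hs : 1 / κ < s) :
    Summable fun ℓ : ℕ => (psPart κ (ℓ + 1) : ℝ) ^ (-s) := by
  have hs0 : 0 < s := (by positivity : 0 < 1 / κ).trans hs
  have h1 : Summable fun ℓ : ℕ => (1 / 2 : ℝ) ^ (-s) * ((ℓ : ℝ) + 1) ^ (-(κ * s)) := by
    apply Summable.mul_left
    have h := (Real.summable_nat_rpow (p := -(κ * s))).2 (by
      rw [div_lt_iff₀ hκ] at hs
      linarith)
    have := (summable_nat_add_iff 1).2 h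
    simpa using this
  refine Summable.of_nonneg_of_le (fun ℓ => by positivity) (fun ℓ => ?_) h1
  have h2 := rpow_div_two_le_psPart hκ ℓ
  have h3 : (0 : ℝ) < ((ℓ : ℝ) + 1) ^ κ / 2 := by positivity
  refine (Real.rpow_le_rpow_of_nonpos h3 h2 (by linarith)).trans (le_of_eq ?_)
  rw [div_eq_mul_one_div, mul_comm, Real.mul_rpow (by norm_num) (by positivity),
    ← Real.rpow_mul (by positivity), mul_neg]

lemma exists_negLog_bound {κ s : ℝ} (hκ : 0 < κ) (hs : 1 / κ < s) :
    ∃ u : ℕ → ℝ, Summable u ∧ ∀ ℓ, ∀ z : ℂ, 0 < z.re →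
      ‖negLog (psPart κ (ℓ + 1) * z)‖ ≤ u ℓ * z.re ^ (-s) := by
  have hs0 : 0 < s := (by positivity : 0 < 1 / κ).trans hs
  obtain ⟨C, hC, h⟩ := norm_negLog_le hs0
  refine ⟨_, (summable_psPart hκ hs).mul_left C, fun ℓ z hz => ?_⟩
  have ha := psPart_pos hκ ℓ
  refine (h _ (by rw [re_natCast_mul]; positivity)).trans (le_of_eq ?_)
  rw [re_natCast_mul, Real.mul_rpow ha.le hz.le, mul_assoc]

lemma exists_psTerm_bound {κ s : ℝ} (hκ : 0 < κ) (m : ℕ) (hs : 1 / κ < s) :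
    ∃ u : ℕ → ℝ, Summable u ∧ ∀ ℓ, ∀ z : ℂ, 0 < z.re → ‖psTerm κ m ℓ z‖ ≤ u ℓ * z.re ^ (-s) := by
  obtain ⟨u, hu, h⟩ := exists_negLog_bound hκ hs
  have hs0 : 0 < s := (by positivity : 0 < 1 / κ).trans hs
  refine ⟨fun ℓ => u ℓ + u ℓ, hu.add hu, fun ℓ z hz => ?_⟩
  have hu0 : 0 ≤ u ℓ := by
    have := (norm_nonneg _).trans (h ℓ 1 (by simp))
    simpa using this
  have h1 : 0 < (((m : ℂ) + 1) * z).re := by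
    rw [re_natCast_add_one_mul]
    positivity
  have h2 := h ℓ _ h1
  have h3 : (((m : ℂ) + 1) * z).re ^ (-s) ≤ z.re ^ (-s) := by
    apply Real.rpow_le_rpow_of_nonpos hz _ (by linarith)
    rw [re_natCast_add_one_mul]
    have : (0 : ℝ) ≤ m := by positivity
    nlinarith
  refine (norm_sub_le _ _).trans ?_
  change _ ≤ (u ℓ + u ℓ) * _
  rw [add_mul (u ℓ)]
  refine add_le_add (h ℓ z hz) ?_
  rw [mul_left_comm]
  exact h2.trans (by gcongr)

lemma differentiableOn_psTerm {κ : ℝ} (hκ : 0 < κ) (m ℓ : ℕ) :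
    DifferentiableOn ℂ (psTerm κ m ℓ) {z | 0 < z.re} := by
  have h1 := differentiableOn_negLog_mul _ (psPart_pos hκ ℓ)
  have h2 := differentiableOn_negLog_mul ((m + 1) * psPart κ (ℓ + 1)) (by
    have := psPart_pos hκ ℓ
    push_cast
    positivity)
  refine (h1.sub h2).congr fun z _ => ?_
  simp [psTerm, mul_assoc]

lemma psTerm_ofReal {κ : ℝ} (hκ : 0 < κ) (m ℓ : ℕ) {x : ℝ} (hx : 0 < x) :
    psTerm κ m ℓ x = (Real.log (expMoment m 0 (psPart κ (ℓ + 1) * x)) : ℝ) := by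
  have ha := psPart_pos hκ ℓ
  set a := psPart κ (ℓ + 1)
  have hax : 0 < (a : ℝ) * x := by positivity
  have hm : 0 < ((m : ℝ) + 1) * (a * x) := by positivity
  have e1 := negLog_ofReal hax
  have e2 := negLog_ofReal hm
  push_cast at e1 e2
  have h1 : 0 < 1 - Real.exp (-(a * x)) := by
    have := Real.exp_lt_one_iff.2 (neg_lt_zero.2 hax)
    linarith
  rw [psTerm, e1, e2]
  have h3 := expMoment_zero_mul m (a * x)
  have h4 := congrArg Real.log h3
  rw [Real.log_mul (expMoment_zero_pos m _).ne' h1.ne'] at h4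
  rw [show Real.log (expMoment m 0 (a * x)) = Real.log (1 - Real.exp (-((m + 1) * (a * x))))
    - Real.log (1 - Real.exp (-(a * x))) by linarith]
  push_cast
  ring

lemma deriv_psTerm_ofReal {κ : ℝ} (hκ : 0 < κ) (m ℓ : ℕ) {x : ℝ} (hx : 0 < x) :
    deriv (psTerm κ m ℓ) x = ((psPart κ (ℓ + 1) *
      -(expMoment m 1 (psPart κ (ℓ + 1) * x) / expMoment m 0 (psPart κ (ℓ + 1) * x)) : ℝ) : ℂ) := by
  rw [(hasDerivAt_real_of_ofReal_eq (differentiableOn_psTerm hκ m ℓ)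
    (fun t ht => psTerm_ofReal hκ m ℓ ht) hx).2]
  congr 1
  have h := (hasDerivAt_log_expMoment m (psPart κ (ℓ + 1) * x)).comp x
    ((hasDerivAt_id x).const_mul (psPart κ (ℓ + 1) : ℝ))
  rw [mul_one, mul_comm] at h
  exact h.deriv

lemma deriv_deriv_psTerm_ofReal {κ : ℝ} (hκ : 0 < κ) (m ℓ : ℕ) {x : ℝ} (hx : 0 < x) :
    deriv (deriv (psTerm κ m ℓ)) x = ((psPart κ (ℓ + 1) ^ 2 *
      ((expMoment m 2 (psPart κ (ℓ + 1) * x) * expMoment m 0 (psPart κ (ℓ + 1) * x) -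
        expMoment m 1 (psPart κ (ℓ + 1) * x) ^ 2) /
        expMoment m 0 (psPart κ (ℓ + 1) * x) ^ 2) : ℝ) : ℂ) := by
  rw [(hasDerivAt_real_of_ofReal_eq ((differentiableOn_psTerm hκ m ℓ).deriv isOpen_re_pos)
    (fun t ht => deriv_psTerm_ofReal hκ m ℓ ht) hx).2]
  congr 1
  have h := ((hasDerivAt_expMoment_div m (psPart κ (ℓ + 1) * x)).comp x
    ((hasDerivAt_id x).const_mul (psPart κ (ℓ + 1) : ℝ))).const_mul (psPart κ (ℓ + 1) : ℝ)
  refine h.deriv.trans ?_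
  ring

lemma exists_le_sum_psPart_pow {κ : ℝ} (hκ : 0 < κ) (p : ℕ) :
    ∃ c > 0, ∀ y : ℝ, 0 < y → y ≤ 1 →
      c * (y ^ (-(1 / κ)) * (1 / y) ^ p)
        ≤ ∑ ℓ ∈ Finset.range ⌊y ^ (-(1 / κ))⌋₊, (psPart κ (ℓ + 1) : ℝ) ^ p := by
  refine ⟨1 / 4 * ((1 / 4) ^ κ / 2) ^ p, by positivity, fun y hy hy1 => ?_⟩
  set M := y ^ (-(1 / κ)) with hM
  have hM1 : 1 ≤ M := Real.one_le_rpow_of_pos_of_le_one_of_nonpos hy hy1 (by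
    have : 0 < 1 / κ := by positivity
    linarith)
  have hMκ : M ^ κ = 1 / y := by
    rw [hM, ← Real.rpow_mul hy.le, neg_mul, one_div_mul_cancel hκ.ne', Real.rpow_neg_one, one_div]
  set N := ⌊M⌋₊ with hN
  have hN1 : 1 ≤ N := Nat.one_le_floor_iff M |>.2 hM1
  have hN1' : (1 : ℝ) ≤ N := by exact_mod_cast hN1
  have hNM : M / 2 ≤ N := by
    have := Nat.lt_floor_add_one M
    linarith
  have h1 : ∀ ℓ ∈ Finset.Ico (N / 2) N,
      (((1 / 4) ^ κ / 2) * (1 / y)) ^ p ≤ (psPart κ (ℓ + 1) : ℝ) ^ p := by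
    intro ℓ hl
    rw [Finset.mem_Ico] at hl
    have h2 : N ≤ 2 * (ℓ + 1) := by omega
    have h2' : (N : ℝ) ≤ 2 * (ℓ + 1) := by exact_mod_cast h2
    have h3 : (M / 4) ^ κ ≤ ((ℓ : ℝ) + 1) ^ κ :=
      Real.rpow_le_rpow (by positivity) (by linarith) hκ.le
    have h4 := rpow_div_two_le_psPart hκ ℓ
    apply pow_le_pow_left₀ (by positivity)
    rw [div_eq_mul_one_div M, Real.mul_rpow (by positivity) (by norm_num), hMκ] at h3
    linarith
  calc _ = M / 4 * (((1 / 4) ^ κ / 2) * (1 / y)) ^ p := by rw [mul_pow]; ring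
    _ ≤ ((Finset.Ico (N / 2) N).card : ℝ) * (((1 / 4) ^ κ / 2) * (1 / y)) ^ p := by
        gcongr
        rw [Nat.card_Ico]
        have : N ≤ 2 * (N - N / 2) := by omega
        have : (N : ℝ) ≤ 2 * (N - N / 2 : ℕ) := by exact_mod_cast this
        linarith
    _ ≤ ∑ ℓ ∈ Finset.Ico (N / 2) N, (psPart κ (ℓ + 1) : ℝ) ^ p := by
        rw [← nsmul_eq_mul]
        exact Finset.card_nsmul_le_sum _ _ _ h1
    _ ≤ _ := by
        apply Finset.sum_le_sum_of_subset_of_nonneg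
        · intro ℓ hl
          simp at hl ⊢
          omega
        · intro _ _ _
          positivity

lemma psPart_mul_le {κ y : ℝ} (hκ : 0 < κ) (hy : 0 < y) {ℓ : ℕ} {t : ℝ}
    (hl : ((ℓ : ℝ) + 1) ≤ t * y ^ (-(1 / κ))) (ht : 0 < t) : psPart κ (ℓ + 1) * y ≤ t ^ κ := by
  have h1 := psPart_le κ (ℓ + 1)
  push_cast at h1
  have h2 := Real.rpow_le_rpow (by positivity) hl hκ.le
  rw [Real.mul_rpow ht.le (by positivity), ← Real.rpow_mul hy.le, neg_mul,
    one_div_mul_cancel hκ.ne', Real.rpow_neg_one, ← div_eq_mul_inv, le_div_iff₀ hy] at h2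
  nlinarith

section

variable {κ : ℝ}

lemma exists_gt_one_div (κ : ℝ) (hκ : 0 < κ) : 0 ≤ 1 / κ + 1 ∧ 1 / κ < 1 / κ + 1 :=
  ⟨by positivity, by linarith⟩

lemma differentiableOn_psLog (hκ : 0 < κ) (m : ℕ) :
    DifferentiableOn ℂ (psLog κ m) {z | 0 < z.re} := by
  obtain ⟨h0, h1⟩ := exists_gt_one_div κ hκ
  obtain ⟨u, hu, hb⟩ := exists_psTerm_bound hκ m h1
  exact (tsum_re_bound h0 hu (differentiableOn_psTerm hκ m) hb).1

lemma summable_psTerm (hκ : 0 < κ) (m : ℕ) {z : ℂ} (hz : 0 < z.re) :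
    Summable fun ℓ => psTerm κ m ℓ z := by
  obtain ⟨h0, h1⟩ := exists_gt_one_div κ hκ
  obtain ⟨u, hu, hb⟩ := exists_psTerm_bound hκ m h1
  exact (tsum_re_bound h0 hu (differentiableOn_psTerm hκ m) hb).2.1 z hz

lemma exists_norm_psLog_le (hκ : 0 < κ) (m : ℕ) {s : ℝ} (hs : 1 / κ < s) :
    ∃ A > 0, ∀ z : ℂ, 0 < z.re → ‖psLog κ m z‖ ≤ A * z.re ^ (-s) := by
  have h0 : 0 ≤ s := (by positivity : 0 ≤ 1 / κ).trans hs.le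
  obtain ⟨u, hu, hb⟩ := exists_psTerm_bound hκ m hs
  have h := (tsum_re_bound h0 hu (differentiableOn_psTerm hκ m) hb).2.2.1
  refine ⟨|∑' ℓ, u ℓ| + 1, by positivity, fun z hz => (h z hz).trans ?_⟩
  gcongr
  linarith [le_abs_self (∑' ℓ, u ℓ)]

lemma hasSum_deriv_psTerm (hκ : 0 < κ) (m : ℕ) {z : ℂ} (hz : 0 < z.re) :
    HasSum (fun ℓ => deriv (psTerm κ m ℓ) z) (deriv (psLog κ m) z) := by
  obtain ⟨h0, h1⟩ := exists_gt_one_div κ hκ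
  obtain ⟨u, hu, hb⟩ := exists_psTerm_bound hκ m h1
  exact (tsum_re_bound h0 hu (differentiableOn_psTerm hκ m) hb).2.2.2 z hz

lemma hasSum_deriv_deriv_psTerm (hκ : 0 < κ) (m : ℕ) {z : ℂ} (hz : 0 < z.re) :
    HasSum (fun ℓ => deriv (deriv (psTerm κ m ℓ)) z) (deriv (deriv (psLog κ m)) z) := by
  obtain ⟨h0, h1⟩ := exists_gt_one_div κ hκ
  obtain ⟨u, hu, hb⟩ := exists_psTerm_bound hκ m h1
  have h := (tsum_re_bound (by linarith) (hu.mul_left (2 ^ (1 / κ + 1 + 1)))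
    (fun ℓ => (differentiableOn_psTerm hκ m ℓ).deriv isOpen_re_pos)
    (fun ℓ w hw => norm_deriv_le_of_re_bound h0 (differentiableOn_psTerm hκ m ℓ)
      (hb ℓ) hw)).2.2.2 z hz
  have e : deriv (psLog κ m) =ᶠ[𝓝 z] fun w => ∑' ℓ, deriv (psTerm κ m ℓ) w := by
    filter_upwards [isOpen_re_pos.mem_nhds hz] with w hw
    exact (hasSum_deriv_psTerm hκ m hw).tsum_eq.symm
  rwa [e.deriv_eq]

lemma exists_deriv_psLog_lower (hκ : 0 < κ) {m : ℕ} (hm : 1 ≤ m) :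
    ∃ c > 0, ∀ y : ℝ, 0 < y → y ≤ 1 →
      c * (y ^ (-(1 / κ)) * (1 / y)) ≤ -(deriv (psLog κ m) y).re ∧
      c * (y ^ (-(1 / κ)) * (1 / y) ^ 2) ≤ (deriv (deriv (psLog κ m)) y).re := by
  obtain ⟨c1, hc1, h1⟩ := exists_le_sum_psPart_pow hκ 1
  obtain ⟨c2, hc2, h2⟩ := exists_le_sum_psPart_pow hκ 2
  set h := Real.exp (-1) / (m + 1) ^ 2 with hh
  have hh0 : 0 < h := by positivity
  refine ⟨h * min c1 c2, by positivity, fun y hy hy1 => ?_⟩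
  have hre : 0 < (y : ℂ).re := by simpa using hy
  set M := y ^ (-(1 / κ)) with hM
  have hM0 : 0 < M := by positivity
  have hsmall : ∀ ℓ ∈ Finset.range ⌊M⌋₊, (psPart κ (ℓ + 1) : ℝ) * y ≤ 1 := by
    intro ℓ hl
    rw [Finset.mem_range] at hl
    have h3 : ((ℓ + 1 : ℕ) : ℝ) ≤ M := (Nat.cast_le.2 hl).trans (Nat.floor_le hM0.le)
    have := psPart_mul_le hκ hy (ℓ := ℓ) (t := 1) (by push_cast at h3; linarith) one_pos
    rwa [Real.one_rpow] at this
  have hS0 : ∀ ℓ ∈ Finset.range ⌊M⌋₊, expMoment m 0 (psPart κ (ℓ + 1) * y) ≤ m + 1 :=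
    fun ℓ _ => expMoment_zero_le m (by positivity)
  have hexp : ∀ ℓ ∈ Finset.range ⌊M⌋₊, Real.exp (-1) ≤ Real.exp (-(psPart κ (ℓ + 1) * y)) :=
    fun ℓ hl => Real.exp_le_exp.2 (neg_le_neg (hsmall ℓ hl))
  constructor
  · have hs := Complex.hasSum_re (hasSum_deriv_psTerm hκ m hre)
    simp_rw [deriv_psTerm_ofReal hκ m _ hy, Complex.ofReal_re] at hs
    have h3 := sum_le_hasSum (Finset.range ⌊M⌋₊) (fun ℓ _ => by
      rw [mul_neg, neg_neg]
      have := expMoment_nonneg m 1 (psPart κ (ℓ + 1) * y)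
      have := expMoment_zero_pos m (psPart κ (ℓ + 1) * y)
      positivity) hs.neg
    refine le_trans ?_ h3
    calc _ ≤ h * c1 * (M * (1 / y)) := by
          gcongr
          exact min_le_left _ _
      _ ≤ h * ∑ ℓ ∈ Finset.range ⌊M⌋₊, (psPart κ (ℓ + 1) : ℝ) ^ 1 := by
          have := h1 y hy hy1
          rw [pow_one] at this
          rw [mul_assoc]
          gcongr
      _ ≤ _ := by
          rw [Finset.mul_sum]
          apply Finset.sum_le_sum
          intro ℓ hl
          rw [mul_neg, neg_neg, pow_one, mul_comm]
          gcongr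
          rw [hh, le_div_iff₀ (expMoment_zero_pos m _)]
          have e1 := hS0 ℓ hl
          have e2 := (hexp ℓ hl).trans (exp_neg_le_expMoment hm 1 _)
          refine le_trans ?_ e2
          calc _ ≤ Real.exp (-1) / (m + 1) ^ 2 * (m + 1) := by gcongr
            _ = Real.exp (-1) / (m + 1) := by field_simp
            _ ≤ Real.exp (-1) := div_le_self (by positivity) (by
              have : (0 : ℝ) ≤ m := by positivity
              linarith)
  · have hs := Complex.hasSum_re (hasSum_deriv_deriv_psTerm hκ m hre)
    simp_rw [deriv_deriv_psTerm_ofReal hκ m _ hy, Complex.ofReal_re] at hs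
    have hdet : ∀ x, 0 ≤ expMoment m 2 x * expMoment m 0 x - expMoment m 1 x ^ 2 :=
      fun x => (Real.exp_pos _).le.trans (exp_neg_le_expMoment_det hm x)
    have h3 := sum_le_hasSum (Finset.range ⌊M⌋₊) (fun ℓ _ => by
      have := hdet (psPart κ (ℓ + 1) * y)
      have := expMoment_zero_pos m (psPart κ (ℓ + 1) * y)
      positivity) hs
    refine le_trans ?_ h3
    calc _ ≤ h * c2 * (M * (1 / y) ^ 2) := by
          gcongr
          exact min_le_right _ _
      _ ≤ h * ∑ ℓ ∈ Finset.range ⌊M⌋₊, (psPart κ (ℓ + 1) : ℝ) ^ 2 := by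
          have := h2 y hy hy1
          rw [mul_assoc]
          gcongr
      _ ≤ _ := by
          rw [Finset.mul_sum]
          apply Finset.sum_le_sum
          intro ℓ hl
          rw [mul_comm]
          gcongr
          have e0 := expMoment_zero_pos m (psPart κ (ℓ + 1) * y)
          have e1 := hS0 ℓ hl
          have e2 := (hexp ℓ hl).trans (exp_neg_le_expMoment_det hm _)
          have e3 := hdet (psPart κ (ℓ + 1) * y)
          rw [hh]
          gcongr

end

/-- The series `L_κ` on the right half plane. -/
noncomputable def psNegLog (κ : ℝ) (z : ℂ) : ℂ := ∑' ℓ : ℕ, negLog (psPart κ (ℓ + 1) * z)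

section

variable {κ : ℝ}

lemma psNegLog_props (hκ : 0 < κ) : DifferentiableOn ℂ (psNegLog κ) {z | 0 < z.re} ∧
    ∀ z : ℂ, 0 < z.re → Summable fun ℓ : ℕ => negLog (psPart κ (ℓ + 1) * z) := by
  obtain ⟨h0, h1⟩ := exists_gt_one_div κ hκ
  obtain ⟨u, hu, hb⟩ := exists_negLog_bound hκ h1
  have h := tsum_re_bound h0 hu (fun ℓ => differentiableOn_negLog_mul _ (psPart_pos hκ ℓ)) hb
  exact ⟨h.1, h.2.1⟩

lemma psNegLog_ofReal (hκ : 0 < κ) {x : ℝ} (hx : 0 < x) : psNegLog κ x = Lk κ x := by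
  rw [psNegLog, Lk, ← tsum_neg, Complex.ofReal_tsum]
  refine tsum_congr fun ℓ => ?_
  have h := negLog_ofReal (mul_pos (psPart_pos hκ ℓ) hx)
  push_cast at h ⊢
  rw [h]
  congr 4
  ring_nf

lemma psLog_eq (hκ : 0 < κ) (m : ℕ) {z : ℂ} (hz : 0 < z.re) :
    psLog κ m z = psNegLog κ z - psNegLog κ ((m + 1) * z) := by
  have hz' : 0 < (((m : ℂ) + 1) * z).re := by
    rw [re_natCast_add_one_mul]
    positivity
  rw [psLog, psNegLog, psNegLog, ← ((psNegLog_props hκ).2 _ hz).tsum_sub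
    ((psNegLog_props hκ).2 _ hz')]
  refine tsum_congr fun ℓ => ?_
  rw [psTerm, mul_left_comm]

lemma hasDerivAt_Lk (hκ : 0 < κ) {x : ℝ} (hx : 0 < x) :
    HasDerivAt (Lk κ) (deriv (Lk κ) x) x ∧ deriv (psNegLog κ) x = deriv (Lk κ) x :=
  hasDerivAt_real_of_ofReal_eq (psNegLog_props hκ).1 (fun _ ht => psNegLog_ofReal hκ ht) hx

lemma hasDerivAt_deriv_Lk (hκ : 0 < κ) {x : ℝ} (hx : 0 < x) :
    HasDerivAt (deriv (Lk κ)) (deriv (deriv (Lk κ)) x) x :=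
  (hasDerivAt_real_of_ofReal_eq ((psNegLog_props hκ).1.deriv isOpen_re_pos)
    (fun _ ht => (hasDerivAt_Lk hκ ht).2) hx).1

lemma psLog_ofReal (hκ : 0 < κ) (m : ℕ) {x : ℝ} (hx : 0 < x) :
    psLog κ m x = ((Lk κ x - Lk κ ((m + 1) * x) : ℝ) : ℂ) := by
  have h := psNegLog_ofReal hκ (x := (m + 1) * x) (by positivity)
  push_cast at h ⊢
  rw [psLog_eq hκ m (by simpa using hx), psNegLog_ofReal hκ hx, h]

lemma deriv_psLog_ofReal (hκ : 0 < κ) (m : ℕ) {x : ℝ} (hx : 0 < x) :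
    deriv (psLog κ m) x =
      ((deriv (Lk κ) x - (m + 1) * deriv (Lk κ) ((m + 1) * x) : ℝ) : ℂ) := by
  rw [(hasDerivAt_real_of_ofReal_eq (differentiableOn_psLog hκ m)
    (fun _ ht => psLog_ofReal hκ m ht) hx).2]
  congr 1
  have h := (hasDerivAt_Lk hκ (x := (m + 1) * x) (by positivity)).1.comp x
    ((hasDerivAt_id' x).const_mul ((m : ℝ) + 1))
  refine ((hasDerivAt_Lk hκ hx).1.sub h).deriv.trans ?_
  ring

lemma deriv_deriv_psLog_ofReal (hκ : 0 < κ) (m : ℕ) {x : ℝ} (hx : 0 < x) :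
    deriv (deriv (psLog κ m)) x = ((deriv (deriv (Lk κ)) x -
      (m + 1) ^ 2 * deriv (deriv (Lk κ)) ((m + 1) * x) : ℝ) : ℂ) := by
  rw [(hasDerivAt_real_of_ofReal_eq ((differentiableOn_psLog hκ m).deriv isOpen_re_pos)
    (fun _ ht => deriv_psLog_ofReal hκ m ht) hx).2]
  congr 1
  have h := ((hasDerivAt_deriv_Lk hκ (x := (m + 1) * x) (by positivity)).comp x
    ((hasDerivAt_id' x).const_mul ((m : ℝ) + 1))).const_mul ((m : ℝ) + 1)
  refine ((hasDerivAt_deriv_Lk hκ hx).sub h).deriv.trans ?_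
  ring

lemma deriv_deriv_deriv_psLog_im (hκ : 0 < κ) (m : ℕ) {x : ℝ} (hx : 0 < x) :
    (deriv (deriv (deriv (psLog κ m))) x).im = 0 := by
  rw [(hasDerivAt_real_of_ofReal_eq
    (((differentiableOn_psLog hκ m).deriv isOpen_re_pos).deriv isOpen_re_pos)
    (fun _ ht => deriv_deriv_psLog_ofReal hκ m ht) hx).2, Complex.ofReal_im]

end

/-- The finite generating function `∏_{ℓ < N} (1 + q^{a_ℓ} + ⋯ + q^{m a_ℓ})` at `q = e^{-z}`. -/
noncomputable def psProd (κ : ℝ) (m N : ℕ) (z : ℂ) : ℂ :=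
  ∏ ℓ ∈ Finset.range N, ∑ j ∈ Finset.range (m + 1), Complex.exp (-(j * (psPart κ (ℓ + 1) * z)))

lemma exp_psTerm {κ : ℝ} (hκ : 0 < κ) (m ℓ : ℕ) {z : ℂ} (hz : 0 < z.re) :
    Complex.exp (psTerm κ m ℓ z)
      = ∑ j ∈ Finset.range (m + 1), Complex.exp (-(j * (psPart κ (ℓ + 1) * z))) := by
  set w := (psPart κ (ℓ + 1) : ℂ) * z with hw
  have hwre : 0 < w.re := by
    rw [hw, re_natCast_mul]
    exact mul_pos (psPart_pos hκ ℓ) hz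
  have hmre : 0 < (((m : ℂ) + 1) * w).re := by
    rw [re_natCast_add_one_mul]
    positivity
  have h1 := exp_negLog hwre
  have h2 := exp_negLog hmre
  have h3 := geom_sum_mul (Complex.exp (-w)) (m + 1)
  have e : ∑ j ∈ Finset.range (m + 1), Complex.exp (-(j * w))
      = ∑ i ∈ Finset.range (m + 1), Complex.exp (-w) ^ i := by
    refine Finset.sum_congr rfl fun j _ => ?_
    rw [← Complex.exp_nat_mul]
    congr 1
    ring
  rw [← Complex.exp_nat_mul] at h3
  push_cast at h3
  rw [mul_neg] at h3
  have h4 : Complex.exp (negLog ((m + 1) * w)) ≠ 0 := Complex.exp_ne_zero _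
  rw [psTerm, Complex.exp_sub, e, div_eq_iff h4]
  linear_combination (-(Complex.exp (negLog w)) * h2) +
    (Complex.exp (negLog ((m + 1) * w)) * (∑ i ∈ Finset.range (m + 1), Complex.exp (-w) ^ i)) * h1 +
    (Complex.exp (negLog ((m + 1) * w)) * Complex.exp (negLog w)) * h3

lemma psProd_eq_exp {κ : ℝ} (hκ : 0 < κ) (m N : ℕ) {z : ℂ} (hz : 0 < z.re) :
    psProd κ m N z = Complex.exp (∑ ℓ ∈ Finset.range N, psTerm κ m ℓ z) := by
  rw [psProd, Complex.exp_sum]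
  exact Finset.prod_congr rfl fun ℓ _ => (exp_psTerm hκ m ℓ hz).symm

lemma tendsto_psProd {κ : ℝ} (hκ : 0 < κ) (m : ℕ) {z : ℂ} (hz : 0 < z.re) :
    Tendsto (fun N => psProd κ m N z) atTop (𝓝 (Complex.exp (psLog κ m z))) := by
  simp_rw [psProd_eq_exp hκ m _ hz]
  exact (Complex.continuous_exp.tendsto _).comp
    (summable_psTerm hκ m hz).hasSum.tendsto_sum_nat

lemma integral_exp_int (k : ℤ) :
    ∫ θ in (-π)..π, Complex.exp (k * (θ * Complex.I)) = if k = 0 then (2 * π : ℂ) else 0 := by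
  split_ifs with h
  · subst h
    simp
    ring
  have hc : (k : ℂ) * Complex.I ≠ 0 := mul_ne_zero (by exact_mod_cast h) Complex.I_ne_zero
  have e : ∀ θ : ℝ, (k : ℂ) * (θ * Complex.I) = (k * Complex.I) * θ := fun θ => by ring
  simp_rw [e]
  rw [integral_exp_mul_complex hc, div_eq_zero_iff, sub_eq_zero]
  left
  rw [Complex.exp_eq_exp_iff_exists_int]
  refine ⟨k, ?_⟩
  push_cast
  ring

lemma psProd_expand (κ : ℝ) (m N : ℕ) (z : ℂ) :
    psProd κ m N z = ∑ p ∈ Fintype.piFinset (fun _ : Fin N => Finset.range (m + 1)),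
      Complex.exp (-((∑ i, p i * psPart κ (i + 1) : ℕ) * z)) := by
  rw [psProd, Finset.prod_range (fun ℓ => ∑ j ∈ Finset.range (m + 1),
    Complex.exp (-(j * (psPart κ (ℓ + 1) * z)))), Finset.prod_univ_sum]
  refine Finset.sum_congr rfl fun p _ => ?_
  rw [← Complex.exp_sum]
  congr 1
  push_cast
  rw [Finset.sum_neg_distrib, Finset.sum_mul]
  congr 1
  refine Finset.sum_congr rfl fun i _ => ?_
  ring

lemma eventually_lt_psPart {κ : ℝ} (hκ : 0 < κ) (n : ℕ) :
    ∃ N₀ : ℕ, ∀ ℓ ≥ N₀, n < psPart κ (ℓ + 1) := by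
  have h := ((tendsto_rpow_atTop hκ).comp tendsto_natCast_atTop_atTop).eventually_gt_atTop
    (2 * (n : ℝ))
  obtain ⟨N₀, h⟩ := eventually_atTop.1 h
  refine ⟨N₀, fun ℓ hl => ?_⟩
  have h1 := h (ℓ + 1) (by omega)
  have h2 := rpow_div_two_le_psPart hκ ℓ
  simp at h1
  have : (n : ℝ) < psPart κ (ℓ + 1) := by linarith
  exact_mod_cast this

lemma pkm_eq_card {κ : ℝ} {m n N : ℕ} (hN : ∀ ℓ ≥ N, n < psPart κ (ℓ + 1)) :
    pkm κ m n = ((Fintype.piFinset (fun _ : Fin N => Finset.range (m + 1))).filter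
      (fun p => ∑ i : Fin N, p i * psPart κ ((i : ℕ) + 1) = n)).card := by
  have hsupp : ∀ r : ℕ →₀ ℕ, (r.sum fun ℓ j => j * psPart κ (ℓ + 1)) = n →
      r.support ⊆ Finset.range N := by
    intro r hr ℓ hl
    by_contra hl'
    have h1 := hN ℓ (by simpa using hl')
    have h2 : r ℓ * psPart κ (ℓ + 1) ≤ r.sum fun ℓ j => j * psPart κ (ℓ + 1) :=
      Finset.single_le_sum (f := fun ℓ => r ℓ * psPart κ (ℓ + 1)) (fun _ _ => Nat.zero_le _) hl
    have h3 : 1 ≤ r ℓ := Nat.one_le_iff_ne_zero.2 (Finsupp.mem_support_iff.1 hl)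
    nlinarith
  have hsum : ∀ r : ℕ →₀ ℕ, r.support ⊆ Finset.range N →
      (r.sum fun ℓ j => j * psPart κ (ℓ + 1)) = ∑ i : Fin N, r i * psPart κ ((i : ℕ) + 1) := by
    intro r hr
    rw [Finsupp.sum_of_support_subset r hr _ (by simp),
      Finset.sum_range fun ℓ => r ℓ * psPart κ (ℓ + 1)]
  rw [pkm, ← Nat.card_eq_finsetCard]
  refine Nat.card_congr (Equiv.ofBijective
    (fun r => ⟨fun i => r.1 i, ?_⟩) ⟨?_, ?_⟩)
  · rw [Finset.mem_filter, Fintype.mem_piFinset]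
    refine ⟨fun i => Finset.mem_range.2 (Nat.lt_succ_of_le (r.2.1 i)), ?_⟩
    rw [← hsum r.1 (hsupp r.1 r.2.2), r.2.2]
  · intro r r' h
    have h1 : ∀ i : Fin N, r.1 i = r'.1 i := fun i => congrFun (congrArg Subtype.val h) i
    refine Subtype.ext (Finsupp.ext fun ℓ => ?_)
    by_cases hl : ℓ < N
    · exact h1 ⟨ℓ, hl⟩
    · have hz : ∀ r : {r : ℕ →₀ ℕ // (∀ ℓ, r ℓ ≤ m) ∧
          (r.sum fun ℓ j => j * psPart κ (ℓ + 1)) = n}, r.1 ℓ = 0 := fun r => by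
        by_contra hne
        have := hsupp r.1 r.2.2 (Finsupp.mem_support_iff.2 hne)
        simp [hl] at this
      rw [hz r, hz r']
  · rintro ⟨p, hp⟩
    rw [Finset.mem_filter, Fintype.mem_piFinset] at hp
    let r : ℕ →₀ ℕ := Finsupp.onFinset (Finset.range N)
      (fun ℓ => if h : ℓ < N then p ⟨ℓ, h⟩ else 0) (fun ℓ hl => by
        by_contra hl'
        simp at hl'
        simp [hl'.not_gt] at hl)
    have hr : ∀ i : Fin N, r i = p i := fun i => by simp [r]
    have hrs : r.support ⊆ Finset.range N := Finsupp.support_onFinset_subset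
    refine ⟨⟨r, fun ℓ => ?_, ?_⟩, Subtype.ext (funext hr)⟩
    · by_cases hl : ℓ < N
      · have := hp.1 ⟨ℓ, hl⟩
        rw [← hr, Finset.mem_range] at this
        exact Nat.le_of_lt_succ this
      · have : r ℓ = 0 := by simp [r, hl]
        omega
    · rw [hsum r hrs, ← hp.2]
      exact Finset.sum_congr rfl fun i _ => by rw [hr]

lemma norm_psProd_le {κ : ℝ} (hκ : 0 < κ) (m N : ℕ) {y : ℝ} (hy : 0 < y) (θ : ℝ) :
    ‖psProd κ m N (y + θ * Complex.I)‖ ≤ Real.exp (psLog κ m y).re := by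
  have h1 : ‖psProd κ m N (y + θ * Complex.I)‖ ≤
      ∏ ℓ ∈ Finset.range N, expMoment m 0 (psPart κ (ℓ + 1) * y) := by
    rw [psProd, norm_prod]
    refine Finset.prod_le_prod (fun _ _ => norm_nonneg _) fun ℓ _ => ?_
    refine (norm_sum_le _ _).trans (le_of_eq ?_)
    unfold expMoment
    refine Finset.sum_congr rfl fun j _ => ?_
    rw [Complex.norm_exp]
    simp
  have hre : 0 < (y : ℂ).re := by simpa using hy
  have hs0 : HasSum (fun ℓ => psTerm κ m ℓ y) (psLog κ m y) := (summable_psTerm hκ m hre).hasSum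
  have hs := Complex.hasSum_re hs0
  simp_rw [psTerm_ofReal hκ m _ hy, Complex.ofReal_re] at hs
  have hone : ∀ x, 1 ≤ expMoment m 0 x := fun x => by
    rw [expMoment, Finset.sum_range_succ']
    simp
    positivity
  have h2 := sum_le_hasSum (Finset.range N) (fun ℓ _ => Real.log_nonneg (hone _)) hs
  refine h1.trans ?_
  rw [← Real.exp_log (Finset.prod_pos fun ℓ _ => expMoment_zero_pos m (psPart κ (ℓ + 1) * y))]
  apply Real.exp_le_exp.2
  rw [Real.log_prod (fun ℓ _ => (expMoment_zero_pos m (psPart κ (ℓ + 1) * y)).ne')]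
  exact h2

/-- Cauchy's integral formula for the coefficients of the generating function. -/
lemma integral_exp_psLog {κ : ℝ} (hκ : 0 < κ) (m n : ℕ) {y : ℝ} (hy : 0 < y) :
    ∫ θ in (-π)..π, Complex.exp (psLog κ m (y + θ * Complex.I) + n * (y + θ * Complex.I))
      = 2 * π * pkm κ m n := by
  have hre : ∀ θ : ℝ, 0 < ((y : ℂ) + θ * Complex.I).re := fun θ => by simpa using hy
  have hcont : ∀ N, Continuous fun θ : ℝ =>
      psProd κ m N (y + θ * Complex.I) * Complex.exp (n * (y + θ * Complex.I)) := by
    intro N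
    unfold psProd
    fun_prop
  have hlim : Tendsto (fun N => ∫ θ in (-π)..π,
      psProd κ m N (y + θ * Complex.I) * Complex.exp (n * (y + θ * Complex.I))) atTop
      (𝓝 (∫ θ in (-π)..π,
        Complex.exp (psLog κ m (y + θ * Complex.I) + n * (y + θ * Complex.I)))) := by
    apply intervalIntegral.tendsto_integral_filter_of_dominated_convergence
      (fun _ => Real.exp (psLog κ m y).re * Real.exp (n * y))
    · exact Eventually.of_forall fun N => (hcont N).aestronglyMeasurable
    · refine Eventually.of_forall fun N => Eventually.of_forall fun θ _ => ?_
      rw [norm_mul, Complex.norm_exp]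
      have e : ((n : ℂ) * (y + θ * Complex.I)).re = n * y := by simp
      rw [e]
      gcongr
      exact norm_psProd_le hκ m N hy θ
    · exact intervalIntegrable_const
    · refine Eventually.of_forall fun θ _ => ?_
      simp_rw [Complex.exp_add]
      exact (tendsto_psProd hκ m (hre θ)).mul_const _
  refine tendsto_nhds_unique hlim (tendsto_const_nhds.congr' ?_)
  obtain ⟨N₀, hN₀⟩ := eventually_lt_psPart hκ n
  filter_upwards [eventually_ge_atTop N₀] with N hN
  rw [pkm_eq_card (N := N) (fun ℓ hl => hN₀ ℓ (hN.trans hl)), Finset.card_filter]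
  simp_rw [psProd_expand, Finset.sum_mul]
  rw [intervalIntegral.integral_finsetSum (fun p _ =>
    Continuous.intervalIntegrable (by fun_prop) _ _)]
  push_cast
  rw [Finset.mul_sum]
  refine Finset.sum_congr rfl fun p _ => ?_
  set k := ∑ i : Fin N, p i * psPart κ ((i : ℕ) + 1) with hk
  have e : ∀ θ : ℝ, Complex.exp (-((k : ℕ) * ((y : ℂ) + θ * Complex.I))) *
      Complex.exp (n * (y + θ * Complex.I)) = Complex.exp (((n : ℤ) - (k : ℤ) : ℤ) * y) *
        Complex.exp (((n : ℤ) - (k : ℤ) : ℤ) * (θ * Complex.I)) := fun θ => by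
    rw [← Complex.exp_add, ← Complex.exp_add]
    congr 1
    push_cast
    ring
  have e2 : (∑ i : Fin N, (p i : ℂ) * (psPart κ ((i : ℕ) + 1) : ℂ)) = (k : ℕ) := by
    rw [hk]
    push_cast
    rfl
  simp_rw [e2, e]
  rw [intervalIntegral.integral_const_mul, integral_exp_int]
  by_cases h : k = n
  · simp [h]
  · have : (n : ℤ) - k ≠ 0 := by omega
    rw [if_neg this, if_neg h]
    simp

lemma norm_geom_sum_exp_le {m : ℕ} (hm : 1 ≤ m) {w : ℂ} (hw : 0 ≤ w.re) :
    ‖∑ j ∈ Finset.range (m + 1), Complex.exp (-(j * w))‖ ≤ expMoment m 0 w.re *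
      Real.exp (-(Real.exp (-w.re) * (1 - Real.cos w.im) / (2 * (m + 1)))) := by
  set ρ := Real.exp (-w.re) with hρ
  have hρ0 : 0 < ρ := Real.exp_pos _
  have hρ1 : ρ ≤ 1 := Real.exp_le_one_iff.2 (by linarith)
  set d := 1 - Real.cos w.im with hd
  have hd0 : 0 ≤ d := by linarith [Real.cos_le_one w.im]
  have hd2 : d ≤ 2 := by linarith [Real.neg_one_le_cos w.im]
  have hsq : ‖1 + Complex.exp (-w)‖ ^ 2 = (1 + ρ) ^ 2 - 2 * ρ * d := by
    rw [Complex.sq_norm, Complex.normSq_apply]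
    simp only [Complex.add_re, Complex.one_re, Complex.add_im, Complex.one_im, Complex.exp_re,
      Complex.exp_im, Complex.neg_re, Complex.neg_im, Real.cos_neg, Real.sin_neg]
    have := Real.sin_sq_add_cos_sq w.im
    rw [hd, ← hρ]
    linear_combination ρ ^ 2 * this
  have h1 : ‖1 + Complex.exp (-w)‖ ≤ 1 + ρ - ρ * d / 2 := by
    apply abs_le_of_sq_le_sq' _ _ |>.2
    · rw [hsq]
      nlinarith [mul_nonneg hρ0.le hd0, sq_nonneg (ρ * d / 2),
        mul_nonneg (mul_nonneg hρ0.le hd0) (sub_nonneg.2 hρ1)]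
    · nlinarith
  obtain ⟨k, rfl⟩ : ∃ k, m = k + 1 := ⟨m - 1, by omega⟩
  have h2 : ‖∑ j ∈ Finset.range (k + 1 + 1), Complex.exp (-(j * w))‖
      ≤ expMoment (k + 1) 0 w.re - ρ * d / 2 := by
    unfold expMoment
    rw [Finset.sum_range_succ', Finset.sum_range_succ', Finset.sum_range_succ',
      Finset.sum_range_succ']
    have h3 : ‖∑ j ∈ Finset.range k, Complex.exp (-((j + 1 + 1 : ℕ) * w))‖
        ≤ ∑ j ∈ Finset.range k, ((j + 1 + 1 : ℕ) : ℝ) ^ 0 *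
          Real.exp (-((j + 1 + 1 : ℕ) * w.re)) := by
      refine (norm_sum_le _ _).trans (le_of_eq ?_)
      refine Finset.sum_congr rfl fun j _ => ?_
      rw [Complex.norm_exp, Complex.neg_re, re_natCast_mul, pow_zero, one_mul]
    simp only [zero_add, Nat.cast_one, one_mul, Nat.cast_zero, zero_mul, neg_zero, Complex.exp_zero,
      Real.exp_zero, pow_zero, mul_one] at h3 ⊢
    rw [add_assoc, add_assoc, ← hρ]
    refine (norm_add_le _ _).trans ?_
    rw [add_comm (Complex.exp _)]
    linarith
  refine h2.trans ?_
  have h4 := expMoment_zero_le (k + 1) hw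
  have h5 := expMoment_zero_pos (k + 1) w.re
  have h6 := Real.add_one_le_exp (-(ρ * d / (2 * ((k + 1 : ℕ) + 1 : ℝ))))
  refine le_trans ?_ (mul_le_mul_of_nonneg_left h6 h5.le)
  have h7 : expMoment (k + 1) 0 w.re * (ρ * d / (2 * ((k + 1 : ℕ) + 1 : ℝ))) ≤ ρ * d / 2 := by
    calc _ ≤ ((k + 1 : ℕ) + 1 : ℝ) * (ρ * d / (2 * ((k + 1 : ℕ) + 1 : ℝ))) := by gcongr
      _ = ρ * d / 2 := by field_simp
  linarith

lemma re_psTerm_le {κ : ℝ} (hκ : 0 < κ) {m : ℕ} (hm : 1 ≤ m) (ℓ : ℕ) {y : ℝ} (hy : 0 < y)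
    (θ : ℝ) : (psTerm κ m ℓ (y + θ * Complex.I)).re ≤ (psTerm κ m ℓ y).re -
      Real.exp (-(psPart κ (ℓ + 1) * y)) * (1 - Real.cos (psPart κ (ℓ + 1) * θ)) /
        (2 * (m + 1)) := by
  have hre : 0 < ((y : ℂ) + θ * Complex.I).re := by simpa using hy
  have h1 := exp_psTerm hκ m ℓ hre
  have ha := psPart_pos hκ ℓ
  set w := (psPart κ (ℓ + 1) : ℂ) * ((y : ℂ) + θ * Complex.I) with hw
  have hwre : w.re = psPart κ (ℓ + 1) * y := by simp [hw]
  have hwim : w.im = psPart κ (ℓ + 1) * θ := by simp [hw]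
  have h2 := norm_geom_sum_exp_le hm (w := w) (by rw [hwre]; positivity)
  rw [← h1, Complex.norm_exp, hwre, hwim, ← Real.exp_log (expMoment_zero_pos m _), ← Real.exp_add,
    Real.exp_le_exp] at h2
  rw [psTerm_ofReal hκ m ℓ hy, Complex.ofReal_re]
  linarith

lemma re_psLog_le {κ : ℝ} (hκ : 0 < κ) {m : ℕ} (hm : 1 ≤ m) {y : ℝ} (hy : 0 < y) (θ : ℝ) (N : ℕ) :
    (psLog κ m (y + θ * Complex.I)).re ≤ (psLog κ m y).re - ∑ ℓ ∈ Finset.range N,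
      Real.exp (-(psPart κ (ℓ + 1) * y)) * (1 - Real.cos (psPart κ (ℓ + 1) * θ)) /
        (2 * (m + 1)) := by
  have hs : ∀ z : ℂ, 0 < z.re → HasSum (fun ℓ => (psTerm κ m ℓ z).re) (psLog κ m z).re :=
    fun z hz => Complex.hasSum_re (summable_psTerm hκ m hz).hasSum
  have h1 := hs (y + θ * Complex.I) (by simpa using hy)
  have h2 := hs y (by simpa using hy)
  have h3 := sum_le_hasSum (Finset.range N) (fun ℓ _ => by
    have := re_psTerm_le hκ hm ℓ hy θ
    have h4 : 0 ≤ Real.exp (-(psPart κ (ℓ + 1) * y)) * (1 - Real.cos (psPart κ (ℓ + 1) * θ)) /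
        (2 * (m + 1)) := by
      have := sub_nonneg.2 (Real.cos_le_one (psPart κ (ℓ + 1) * θ))
      positivity
    linarith) (h2.sub h1)
  have h5 : ∑ ℓ ∈ Finset.range N,
      Real.exp (-(psPart κ (ℓ + 1) * y)) * (1 - Real.cos (psPart κ (ℓ + 1) * θ)) / (2 * (m + 1))
      ≤ ∑ ℓ ∈ Finset.range N,
        ((psTerm κ m ℓ y).re - (psTerm κ m ℓ (y + θ * Complex.I)).re) :=
    Finset.sum_le_sum fun ℓ _ => by linarith [re_psTerm_le hκ hm ℓ hy θ]
  linarith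

lemma eight_mul_distInt_sq_le (x : ℝ) : 8 * distInt x ^ 2 ≤ 1 - Real.cos (2 * π * x) := by
  have h1 : Real.cos (2 * π * x) = Real.cos (2 * π * (x - round x)) := by
    rw [mul_sub, mul_comm _ ((round x : ℤ) : ℝ), Real.cos_sub_int_mul_two_pi]
  have h2 : |x - round x| ≤ 1 / 2 := abs_sub_round x
  have h3 := Real.cos_le_one_sub_mul_cos_sq (x := 2 * π * (x - round x)) (by
    rw [abs_mul, abs_of_pos (by positivity)]
    nlinarith [Real.pi_pos])
  rw [h1, distInt, sq_abs]
  have h4 : 2 / π ^ 2 * (2 * π * (x - round x)) ^ 2 = 8 * (x - round x) ^ 2 := by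
    field_simp
    ring
  linarith

lemma tendsto_rpow_neg_one_div {κ : ℝ} (hκ : 0 < κ) :
    Tendsto (fun y : ℝ => y ^ (-(1 / κ))) (𝓝[>] 0) atTop :=
  tendsto_rpow_neg_nhdsGT_zero (neg_lt_zero.2 (by positivity))

/-- Decay of the generating function away from the real point of the circle. -/
lemma exists_re_psLog_decay {κ : ℝ} (hκ : 0 < κ) {m : ℕ} (hm : 1 ≤ m) :
    ∃ c : ℝ, 0 < c ∧ ∀ᶠ y : ℝ in 𝓝[>] (0 : ℝ), ∀ θ : ℝ, |θ| ≤ π →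
      (psLog κ m (y + θ * Complex.I)).re
        ≤ (psLog κ m y).re - c * (min ((θ / y) ^ 2) 1 * y ^ (-(1 / κ))) := by
  obtain ⟨c, hc, h⟩ := exists_sum_distInt_sq hκ
  set c3 : ℝ := ((1 / 2) ^ κ / (2 * π)) ^ 2 with hc3
  have hc30 : 0 < c3 := by positivity
  have hc31 : c3 ≤ 1 := by
    rw [hc3]
    apply pow_le_one₀ (by positivity)
    rw [div_le_one (by positivity)]
    have h1 : ((1 : ℝ) / 2) ^ κ ≤ 1 := Real.rpow_le_one (by norm_num) (by norm_num) hκ.le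
    linarith [Real.pi_gt_three]
  refine ⟨Real.exp (-3 ^ κ) * 8 / (2 * (m + 1)) * (c * (c3 / 2)), by positivity, ?_⟩
  have ht := tendsto_rpow_neg_one_div hκ
  filter_upwards [(tendsto_nat_floor_atTop.comp ht).eventually h, ht.eventually_ge_atTop 1,
    self_mem_nhdsWithin] with y hP hM1 hy θ hθ
  replace hy : 0 < y := hy
  set M := y ^ (-(1 / κ)) with hM
  simp only [Function.comp] at hP
  rw [← hM] at hP
  have hMκ : M ^ κ = 1 / y := by
    rw [hM, ← Real.rpow_mul hy.le, neg_mul, one_div_mul_cancel hκ.ne', Real.rpow_neg_one, one_div]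
  set P := ⌊M⌋₊ with hPdef
  have hPM : (P : ℝ) ≤ M := Nat.floor_le (by linarith)
  have hP2 : M / 2 ≤ P := by
    have h1 := Nat.lt_floor_add_one M
    have h2 : (1 : ℝ) ≤ P := by exact_mod_cast (Nat.one_le_floor_iff M).2 hM1
    linarith
  have h1 := hP (|θ| / (2 * π)) (by positivity) (by
    rw [div_le_iff₀ (by positivity)]
    linarith)
  have h2 : c3 * min ((θ / y) ^ 2) 1 ≤ min ((|θ| / (2 * π) * (P : ℝ) ^ κ) ^ 2) 1 := by
    apply le_min
    · refine (mul_le_mul_of_nonneg_left (min_le_left _ _) hc30.le).trans ?_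
      have h3 : (1 / 2) ^ κ * (1 / y) ≤ (P : ℝ) ^ κ := by
        rw [← hMκ, ← Real.mul_rpow (by norm_num) (by linarith)]
        exact Real.rpow_le_rpow (by linarith) (by linarith) hκ.le
      rw [hc3, ← mul_pow, ← sq_abs]
      apply pow_le_pow_left₀ (abs_nonneg _)
      rw [abs_mul, abs_div θ, abs_of_pos hy,
        abs_of_pos (by positivity : 0 < (1 / 2 : ℝ) ^ κ / (2 * π))]
      calc _ = |θ| / (2 * π) * ((1 / 2) ^ κ * (1 / y)) := by ring
        _ ≤ _ := by gcongr
    · have h3 : min ((θ / y) ^ 2) 1 ≤ 1 := min_le_right _ _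
      have h4 : 0 ≤ min ((θ / y) ^ 2) 1 := le_min (sq_nonneg _) zero_le_one
      nlinarith
  have h3 := re_psLog_le hκ hm hy θ (3 * P)
  have h4 : Real.exp (-3 ^ κ) * 8 / (2 * (m + 1)) *
      ∑ ℓ ∈ Finset.range (3 * P), distInt (|θ| / (2 * π) * psPart κ (ℓ + 1)) ^ 2 ≤
      ∑ ℓ ∈ Finset.range (3 * P), Real.exp (-(psPart κ (ℓ + 1) * y)) *
        (1 - Real.cos (psPart κ (ℓ + 1) * θ)) / (2 * (m + 1)) := by
    rw [Finset.mul_sum]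
    apply Finset.sum_le_sum
    intro ℓ hl
    have h5 := eight_mul_distInt_sq_le (|θ| / (2 * π) * psPart κ (ℓ + 1))
    have e : 2 * π * (|θ| / (2 * π) * psPart κ (ℓ + 1)) = psPart κ (ℓ + 1) * |θ| := by
      field_simp
    have h6 : Real.cos (psPart κ (ℓ + 1) * |θ|) = Real.cos (psPart κ (ℓ + 1) * θ) := by
      rw [← Real.cos_abs (psPart κ (ℓ + 1) * θ), abs_mul, Nat.abs_cast]
    rw [e, h6] at h5
    have h7 : psPart κ (ℓ + 1) * y ≤ 3 ^ κ := by
      refine psPart_mul_le hκ hy ?_ (by norm_num)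
      rw [Finset.mem_range] at hl
      have : ((ℓ + 1 : ℕ) : ℝ) ≤ (3 * P : ℕ) := Nat.cast_le.2 hl
      push_cast at this
      linarith
    calc _ = Real.exp (-3 ^ κ) * (8 * distInt (|θ| / (2 * π) * psPart κ (ℓ + 1)) ^ 2) /
          (2 * (m + 1)) := by ring
      _ ≤ _ := by gcongr
  have h8 : c * (c3 / 2) * (min ((θ / y) ^ 2) 1 * M) ≤
      ∑ ℓ ∈ Finset.range (3 * P), distInt (|θ| / (2 * π) * psPart κ (ℓ + 1)) ^ 2 := by
    refine le_trans ?_ h1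
    have h4 : 0 ≤ min ((θ / y) ^ 2) 1 := le_min (sq_nonneg _) zero_le_one
    calc _ = c * (M / 2 * (c3 * min ((θ / y) ^ 2) 1)) := by ring
      _ ≤ _ := by gcongr
  have h9 := mul_le_mul_of_nonneg_left h8
    (by positivity : 0 ≤ Real.exp (-3 ^ κ) * 8 / (2 * ((m : ℝ) + 1)))
  linarith

/-- Third order Taylor expansion with explicit remainder, for a function which is holomorphic on the
right half plane and dominated by a power of the real part. -/
lemma taylor_of_re_bound {F : ℂ → ℂ} {A s : ℝ} (hs : 0 ≤ s)
    (hF : DifferentiableOn ℂ F {z | 0 < z.re})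
    (hb : ∀ z : ℂ, 0 < z.re → ‖F z‖ ≤ A * z.re ^ (-s)) {y : ℝ} (hy : 0 < y) :
    (∀ w : ℂ, ‖w‖ ≤ y / 4 →
      ‖F (y + w) - F y - deriv F y * w - deriv (deriv F) y * w ^ 2 / 2 -
        deriv (deriv (deriv F)) y * w ^ 3 / 6‖ ≤ 32 * (A * (y / 2) ^ (-s)) * (‖w‖ / y) ^ 4) ∧
      ‖deriv (deriv F) y‖ ≤ 8 * (A * (y / 2) ^ (-s)) / y ^ 2 ∧
      ‖deriv (deriv (deriv F)) y‖ ≤ 48 * (A * (y / 2) ^ (-s)) / y ^ 3 := by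
  set M := A * (y / 2) ^ (-s) with hM
  have hA : 0 ≤ A := by
    have := (norm_nonneg _).trans (hb 1 (by simp))
    simpa using this
  have hM0 : 0 ≤ M := by positivity
  have hre : ∀ w ∈ Metric.closedBall (y : ℂ) (y / 2), y / 2 ≤ w.re := by
    intro w hw
    have h1 := (Complex.abs_re_le_norm (w - y)).trans (mem_closedBall_iff_norm.1 hw)
    rw [Complex.sub_re, Complex.ofReal_re] at h1
    linarith [(abs_le.1 h1).1]
  have hd0 : DifferentiableOn ℂ F (Metric.closedBall (y : ℂ) (y / 2)) := by
    apply hF.mono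
    intro w hw
    have := hre w hw
    simp only [Set.mem_ofPred_eq]
    linarith
  have hd : DiffContOnCl ℂ F (Metric.ball (y : ℂ) (y / 2)) :=
    (hd0.mono Metric.closure_ball_subset_closedBall).diffContOnCl
  have hit : ∀ n : ℕ, ‖iteratedDeriv n F y‖ ≤ n.factorial * M * (2 / y) ^ n := by
    intro n
    have h1 := Complex.norm_iteratedDeriv_le_of_forall_mem_sphere_norm_le n (C := M)
      (by linarith) hd (fun w hw => by
        have h1 := hre w (Metric.sphere_subset_closedBall hw)
        refine (hb w (by linarith)).trans ?_
        rw [hM]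
        gcongr 1
        exact Real.rpow_le_rpow_of_nonpos (by linarith) h1 (by linarith))
    refine h1.trans (le_of_eq ?_)
    rw [div_pow, div_pow]
    field_simp
  have e1 : iteratedDeriv 1 F = deriv F := iteratedDeriv_one
  have e2 : iteratedDeriv 2 F = deriv (deriv F) := by
    rw [iteratedDeriv_succ, e1]
  have e3 : iteratedDeriv 3 F = deriv (deriv (deriv F)) := by
    rw [iteratedDeriv_succ, e2]
  refine ⟨fun w hw => ?_, ?_, ?_⟩
  · have hwb : (y : ℂ) + w ∈ Metric.ball (y : ℂ) (y / 2) := by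
      rw [mem_ball_iff_norm, add_sub_cancel_left]
      linarith
    have h1 := Complex.hasSum_taylorSeries_on_ball (hd0.mono Metric.ball_subset_closedBall) hwb
    have h2 := (hasSum_nat_add_iff' 4).2 h1
    rw [add_sub_cancel_left] at h2
    simp only [Finset.sum_range_succ, Finset.sum_range_zero, e1, e2, e3, iteratedDeriv_zero,
      smul_eq_mul, Nat.factorial_zero, Nat.factorial_one, Nat.factorial_two,
      show Nat.factorial 3 = 6 from rfl] at h2
    set q := 2 * (‖w‖ / y) with hq
    have hq0 : 0 ≤ q := by positivity
    have hq1 : q ≤ 1 / 2 := by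
      rw [hq, ← mul_div_assoc, div_le_iff₀ hy]
      linarith
    have h3 : HasSum (fun n : ℕ => M * q ^ 4 * q ^ n) (M * q ^ 4 * (1 - q)⁻¹) :=
      (hasSum_geometric_of_lt_one hq0 (by linarith)).mul_left _
    have h4 := tsum_of_norm_bounded h3 (f := fun n : ℕ =>
      ((n + 4).factorial : ℂ)⁻¹ * (w ^ (n + 4) * iteratedDeriv (n + 4) F y)) (fun n => by
      rw [norm_mul, norm_mul, norm_inv, Complex.norm_natCast, norm_pow]
      have hf : (0 : ℝ) < (n + 4).factorial := by exact_mod_cast Nat.factorial_pos _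
      calc _ ≤ ((n + 4).factorial : ℝ)⁻¹ * (‖w‖ ^ (n + 4) *
            ((n + 4).factorial * M * (2 / y) ^ (n + 4))) := by
            gcongr
            exact hit (n + 4)
        _ = M * (‖w‖ * (2 / y)) ^ (n + 4) := by
            rw [mul_pow]
            field_simp
        _ = _ := by
            rw [show ‖w‖ * (2 / y) = q by rw [hq]; ring]
            ring)
    have h5 : M * q ^ 4 * (1 - q)⁻¹ ≤ 32 * M * (‖w‖ / y) ^ 4 := by
      have h6 : (1 - q)⁻¹ ≤ 2 := by
        rw [inv_le_comm₀ (by linarith) (by norm_num)]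
        linarith
      calc _ ≤ M * q ^ 4 * 2 := by gcongr
        _ = _ := by rw [hq]; ring
    refine le_trans (le_of_eq ?_) (h4.trans h5)
    rw [h2.tsum_eq]
    congr 1
    push_cast
    ring
  · rw [← e2]
    refine (hit 2).trans (le_of_eq ?_)
    simp [Nat.factorial]
    field_simp
    ring
  · rw [← e3]
    refine (hit 3).trans (le_of_eq ?_)
    simp [Nat.factorial]
    field_simp
    ring

lemma abs_re_exp_sub_one_le {E : ℂ} {r : ℝ} (h1 : ‖E‖ ≤ 1) (h2 : |E.re| ≤ r) :
    |(Complex.exp E).re - 1| ≤ ‖E‖ ^ 2 + r := by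
  have h3 := (Complex.abs_re_le_norm _).trans (Complex.norm_exp_sub_one_sub_id_le h1)
  rw [Complex.sub_re, Complex.sub_re, Complex.one_re] at h3
  rw [abs_le] at *
  constructor <;> linarith [h3.1, h3.2, h2.1, h2.2]

lemma sq_le_exp {x : ℝ} (hx : 0 ≤ x) : x ^ 2 ≤ 64 * Real.exp (x / 4) := by
  have h1 := Real.add_one_le_exp (x / 8)
  have h2 : x ≤ 8 * Real.exp (x / 8) := by linarith
  calc x ^ 2 ≤ (8 * Real.exp (x / 8)) ^ 2 := by gcongr
    _ = _ := by
      rw [mul_pow, ← Real.exp_nat_mul]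
      norm_num
      ring

lemma cube_le_exp {x : ℝ} (hx : 0 ≤ x) : x ^ 3 ≤ 1728 * Real.exp (x / 4) := by
  have h1 := Real.add_one_le_exp (x / 12)
  have h2 : x ≤ 12 * Real.exp (x / 12) := by linarith
  calc x ^ 3 ≤ (12 * Real.exp (x / 12)) ^ 3 := by gcongr
    _ = _ := by
      rw [mul_pow, ← Real.exp_nat_mul]
      norm_num
      ring

/-- Laplace's method with explicit error terms. -/
lemma laplace_bound {Ψ : ℝ → ℂ} {b D d u₀ T η : ℝ} (hΨ : Continuous Ψ) (hb : 0 < b)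
    (hd : |d| ≤ D) (hu0 : 0 < u₀) (hu1 : u₀ ≤ 1) (huT : u₀ ≤ T) (hDu : 2 * D * u₀ ^ 3 ≤ 1)
    (hη : 0 < η)
    (hΨ1 : ∀ u : ℝ, |u| ≤ u₀ → ‖Ψ u + b * u ^ 2 / 2 + Complex.I * d * u ^ 3‖ ≤ D * u ^ 4)
    (hΨ2 : ∀ u : ℝ, u₀ ≤ |u| → |u| ≤ T → (Ψ u).re ≤ Real.log η) :
    |√(b / (2 * π)) * (∫ u in (-T)..T, Complex.exp (Ψ u)).re - 1| ≤
      2 * (64 * D / b ^ 2 + 4 * 1728 * D ^ 2 / b ^ 3 + Real.exp (-(b / 4 * u₀ ^ 2))) +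
        2 * √b * T * η := by
  have hD : 0 ≤ D := (abs_nonneg d).trans hd
  have hT : 0 < T := hu0.trans_le huT
  set Q := 64 * D / b ^ 2 + 4 * 1728 * D ^ 2 / b ^ 3 + Real.exp (-(b / 4 * u₀ ^ 2)) with hQ
  have hQ0 : 0 ≤ Q := by positivity
  set h : ℝ → ℝ := Set.indicator (Set.Ioc (-T) T) (fun u => (Complex.exp (Ψ u)).re) with hh
  have hhalf : ∀ u : ℝ, Real.exp (-(b / 2) * u ^ 2)
      = Real.exp (-(b / 4) * u ^ 2) * Real.exp (-(b / 4) * u ^ 2) := fun u => by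
    rw [← Real.exp_add]
    congr 1
    ring
  have htail : ∀ u : ℝ, u₀ ≤ |u| →
      Real.exp (-(b / 2) * u ^ 2) ≤ Real.exp (-(b / 4) * u ^ 2) * Q := by
    intro u hu
    rw [hhalf]
    gcongr
    have h1 : u₀ ^ 2 ≤ u ^ 2 := by
      rw [← sq_abs u]
      gcongr
    have h2 : Real.exp (-(b / 4) * u ^ 2) ≤ Real.exp (-(b / 4 * u₀ ^ 2)) := by
      apply Real.exp_le_exp.2
      nlinarith
    have h3 : 0 ≤ 64 * D / b ^ 2 + 4 * 1728 * D ^ 2 / b ^ 3 := by positivity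
    linarith
  have hcentral : ∀ u : ℝ, |u| ≤ u₀ →
      |(Complex.exp (Ψ u)).re - Real.exp (-(b / 2) * u ^ 2)|
        ≤ Real.exp (-(b / 4) * u ^ 2) * Q := by
    intro u hu
    set E : ℂ := Ψ u + b * u ^ 2 / 2 with hE
    have h1 := hΨ1 u hu
    have hu3 : |u| ^ 3 ≤ u₀ ^ 3 := by gcongr
    have hu1' : |u| ≤ 1 := hu.trans hu1
    have hu4 : u ^ 4 ≤ |u| ^ 3 := by
      have : u ^ 4 = |u| ^ 3 * |u| := by
        rw [← pow_succ, Even.pow_abs (by decide)]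
      rw [this]
      exact mul_le_of_le_one_right (by positivity) hu1'
    have hEn : ‖E‖ ≤ 2 * D * |u| ^ 3 := by
      have h2 : ‖Complex.I * d * (u : ℂ) ^ 3‖ ≤ D * |u| ^ 3 := by
        rw [norm_mul, norm_mul, Complex.norm_I, one_mul, norm_pow, Complex.norm_real,
          Complex.norm_real, Real.norm_eq_abs, Real.norm_eq_abs]
        gcongr
      have h3 : E = (Ψ u + b * u ^ 2 / 2 + Complex.I * d * u ^ 3) - Complex.I * d * u ^ 3 := by
        rw [hE]
        ring
      rw [h3]
      refine (norm_sub_le _ _).trans ?_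
      nlinarith
    have hEre : |E.re| ≤ D * u ^ 4 := by
      have h2 : E.re = (Ψ u + b * u ^ 2 / 2 + Complex.I * d * u ^ 3).re := by
        rw [Complex.add_re (Ψ u + b * u ^ 2 / 2)]
        have : (Complex.I * d * (u : ℂ) ^ 3).re = 0 := by
          rw [mul_assoc, ← Complex.ofReal_pow, ← Complex.ofReal_mul, Complex.I_mul_re,
            Complex.ofReal_im, neg_zero]
        rw [this, add_zero]
      rw [h2]
      exact (Complex.abs_re_le_norm _).trans h1
    have hE1 : ‖E‖ ≤ 1 := hEn.trans (by nlinarith)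
    have h4 := abs_re_exp_sub_one_le hE1 hEre
    have h5 : Ψ u = ((-(b / 2) * u ^ 2 : ℝ) : ℂ) + E := by
      rw [hE]
      push_cast
      ring
    rw [h5, Complex.exp_add, ← Complex.ofReal_exp, Complex.re_ofReal_mul, ← mul_sub_one, abs_mul,
      abs_of_pos (Real.exp_pos _), hhalf, mul_assoc]
    gcongr
    have hE2 : ‖E‖ ^ 2 ≤ 4 * D ^ 2 * u ^ 6 := by
      calc ‖E‖ ^ 2 ≤ (2 * D * |u| ^ 3) ^ 2 := by gcongr
        _ = 4 * D ^ 2 * |u| ^ 6 := by ring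
        _ = _ := by rw [Even.pow_abs (by decide)]
    have h6 := sq_le_exp (x := b * u ^ 2) (by positivity)
    have h7 := cube_le_exp (x := b * u ^ 2) (by positivity)
    have e : Real.exp (b * u ^ 2 / 4) = (Real.exp (-(b / 4) * u ^ 2))⁻¹ := by
      rw [← Real.exp_neg]
      congr 1
      ring
    rw [e, ← div_eq_mul_inv, le_div_iff₀ (Real.exp_pos _)] at h6 h7
    set g := Real.exp (-(b / 4) * u ^ 2) with hg
    have hg0 : 0 < g := Real.exp_pos _
    have h8 : g * u ^ 4 ≤ 64 / b ^ 2 := by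
      rw [le_div_iff₀ (by positivity)]
      nlinarith
    have h9 : g * u ^ 6 ≤ 1728 / b ^ 3 := by
      rw [le_div_iff₀ (by positivity)]
      nlinarith
    calc g * |(Complex.exp E).re - 1| ≤ g * (4 * D ^ 2 * u ^ 6 + D * u ^ 4) := by
          gcongr
          linarith
      _ = D * (g * u ^ 4) + 4 * D ^ 2 * (g * u ^ 6) := by ring
      _ ≤ D * (64 / b ^ 2) + 4 * D ^ 2 * (1728 / b ^ 3) := by gcongr
      _ ≤ D * (64 / b ^ 2) + 4 * D ^ 2 * (1728 / b ^ 3) + Real.exp (-(b / 4 * u₀ ^ 2)) := by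
          linarith [Real.exp_pos (-(b / 4 * u₀ ^ 2))]
      _ = Q := by rw [hQ]; ring
  have hpoint : ∀ u : ℝ, ‖h u - Real.exp (-(b / 2) * u ^ 2)‖ ≤
      Real.exp (-(b / 4) * u ^ 2) * Q + Set.indicator (Set.Ioc (-T) T) (fun _ => η) u := by
    intro u
    rw [Real.norm_eq_abs]
    have hpos : 0 ≤ Real.exp (-(b / 2) * u ^ 2) := (Real.exp_pos _).le
    by_cases hu : u ∈ Set.Ioc (-T) T
    · rw [hh, Set.indicator_of_mem hu, Set.indicator_of_mem hu]
      rcases le_total |u| u₀ with h1 | h1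
      · linarith [hcentral u h1]
      · have h2 := hΨ2 u h1 (abs_le.2 ⟨hu.1.le, hu.2⟩)
        have h3 : |(Complex.exp (Ψ u)).re| ≤ η := by
          refine (Complex.abs_re_le_norm _).trans ?_
          rw [Complex.norm_exp, ← Real.exp_log hη]
          exact Real.exp_le_exp.2 h2
        have h4 := abs_sub (Complex.exp (Ψ u)).re (Real.exp (-(b / 2) * u ^ 2))
        rw [abs_of_nonneg hpos] at h4
        linarith [htail u h1]
    · rw [hh, Set.indicator_of_notMem hu, Set.indicator_of_notMem hu, zero_sub, abs_neg,
        abs_of_nonneg hpos, add_zero]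
      apply htail
      by_contra hc
      rw [not_le, abs_lt] at hc
      exact hu ⟨by linarith [hc.1], by linarith [hc.2]⟩
  have hcontE : Continuous fun u => Complex.exp (Ψ u) := Complex.continuous_exp.comp hΨ
  have hInt : (∫ u in (-T)..T, Complex.exp (Ψ u)).re = ∫ u, h u := by
    rw [hh, MeasureTheory.integral_indicator measurableSet_Ioc,
      intervalIntegral.integral_of_le (by linarith)]
    exact (integral_re (𝕜 := ℂ)
      ((hcontE.intervalIntegrable (-T) T).1)).symm
  have hhint : MeasureTheory.Integrable h := by
    rw [hh, MeasureTheory.integrable_indicator_iff measurableSet_Ioc]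
    exact ((Complex.continuous_re.comp hcontE).intervalIntegrable (-T) T).1
  have hηint : MeasureTheory.Integrable (Set.indicator (Set.Ioc (-T) T) fun _ : ℝ => η) := by
    rw [MeasureTheory.integrable_indicator_iff measurableSet_Ioc]
    exact (intervalIntegrable_const (a := -T) (b := T)).1
  have hg2 := integrable_exp_neg_mul_sq (b := b / 2) (by positivity)
  have hg4 := integrable_exp_neg_mul_sq (b := b / 4) (by positivity)
  have hmain := MeasureTheory.norm_integral_le_of_norm_le ((hg4.mul_const Q).add hηint)
    (Eventually.of_forall hpoint)
  have hηI : ∫ u, Set.indicator (Set.Ioc (-T) T) (fun _ : ℝ => η) u = (T - -T) * η := by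
    rw [MeasureTheory.integral_indicator measurableSet_Ioc,
      ← intervalIntegral.integral_of_le (by linarith), intervalIntegral.integral_const, smul_eq_mul]
  rw [MeasureTheory.integral_sub hhint hg2] at hmain
  simp only [Pi.add_apply] at hmain
  rw [MeasureTheory.integral_add (hg4.mul_const Q) hηint, MeasureTheory.integral_mul_const,
    integral_gaussian, integral_gaussian, hηI, ← hInt, Real.norm_eq_abs] at hmain
  set r := √(b / (2 * π)) with hr
  have hr0 : 0 ≤ r := Real.sqrt_nonneg _
  have e1 : r * √(π / (b / 2)) = 1 := by
    rw [hr, ← Real.sqrt_mul (by positivity), Real.sqrt_eq_one]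
    field_simp
  have e2 : r * √(π / (b / 4)) ≤ 2 := by
    rw [hr, ← Real.sqrt_mul (by positivity), Real.sqrt_le_left (by norm_num)]
    have : b / (2 * π) * (π / (b / 4)) = 2 := by
      field_simp
      norm_num
    rw [this]
    norm_num
  have e3 : r ≤ √b := by
    rw [hr]
    apply Real.sqrt_le_sqrt
    apply div_le_self hb.le
    linarith [Real.pi_gt_three]
  have e4 : r * (∫ u in (-T)..T, Complex.exp (Ψ u)).re - 1
      = r * ((∫ u in (-T)..T, Complex.exp (Ψ u)).re - √(π / (b / 2))) := by
    rw [mul_sub, e1]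
  rw [e4, abs_mul, abs_of_nonneg hr0]
  calc _ ≤ r * (√(π / (b / 4)) * Q + (T - -T) * η) := by gcongr
    _ = (r * √(π / (b / 4))) * Q + 2 * r * T * η := by ring
    _ ≤ 2 * Q + 2 * √b * T * η := by gcongr

lemma pkm_mul_eq_integral {κ : ℝ} (hκ : 0 < κ) (m n : ℕ) {y : ℝ} (hy : 0 < y) (B : ℝ) :
    (pkm κ m n : ℝ) * √(2 * π * B) * Real.exp (-(psLog κ m y).re - n * y) =
      √(y ^ 2 * B / (2 * π)) * (∫ u in (-(π / y))..(π / y), Complex.exp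
        (psLog κ m (y + (y * u : ℝ) * Complex.I) - psLog κ m y +
          n * ((y * u : ℝ) * Complex.I))).re := by
  have h1 := integral_exp_psLog hκ m n hy
  have hpi : y * (π / y) = π := by field_simp
  have h2 := intervalIntegral.smul_integral_comp_mul_left (a := -(π / y)) (b := π / y) (c := y)
    (f := fun θ : ℝ => Complex.exp (psLog κ m (y + θ * Complex.I) + n * (y + θ * Complex.I)))
  rw [mul_neg, hpi, h1, Complex.real_smul] at h2
  have hreal : psLog κ m y = ((psLog κ m y).re : ℂ) := by
    rw [psLog_ofReal hκ m hy, Complex.ofReal_re]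
  set g := (psLog κ m y).re with hg
  have e : ∀ u : ℝ, Complex.exp (psLog κ m (y + (y * u : ℝ) * Complex.I) +
      n * (y + (y * u : ℝ) * Complex.I)) = (Real.exp (g + n * y) : ℝ) * Complex.exp
        (psLog κ m (y + (y * u : ℝ) * Complex.I) - psLog κ m y +
          n * ((y * u : ℝ) * Complex.I)) := fun u => by
    rw [Complex.ofReal_exp, ← Complex.exp_add, hreal]
    congr 1
    push_cast
    ring
  simp_rw [e] at h2
  rw [intervalIntegral.integral_const_mul] at h2
  set J := ∫ u in (-(π / y))..(π / y), Complex.exp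
        (psLog κ m (y + (y * u : ℝ) * Complex.I) - psLog κ m y +
          n * ((y * u : ℝ) * Complex.I)) with hJ
  have h3 : y * (Real.exp (g + n * y) * J.re) = 2 * π * pkm κ m n := by
    have := congrArg Complex.re h2
    rw [Complex.re_ofReal_mul, Complex.re_ofReal_mul] at this
    rw [this]
    have e4 : (2 * π * pkm κ m n : ℂ) = ((2 * π * pkm κ m n : ℝ) : ℂ) := by
      push_cast
      rfl
    rw [e4, Complex.ofReal_re]
  have h4 : Real.exp (-g - n * y) * Real.exp (g + n * y) = 1 := by
    rw [← Real.exp_add]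
    simp
  have h5 : √(y ^ 2 * B / (2 * π)) = y * √(2 * π * B) / (2 * π) := by
    have : y ^ 2 * B / (2 * π) = (y / (2 * π)) ^ 2 * (2 * π * B) := by
      field_simp
    rw [this, Real.sqrt_mul (by positivity), Real.sqrt_sq (by positivity)]
    ring
  have h6 : (pkm κ m n : ℝ) = y * (Real.exp (g + n * y) * J.re) / (2 * π) := by
    rw [h3]
    field_simp
  rw [h5, h6]
  linear_combination (y * J.re * √(2 * π * B) / (2 * π)) * h4

lemma exists_exp_neg_rpow_le {c q p : ℝ} (hc : 0 < c) (hq : 0 < q) (hp : 0 < p) :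
    ∃ K : ℝ, 0 < K ∧ ∀ y : ℝ, 0 < y → Real.exp (-(c * y ^ (-q))) ≤ K * y ^ p := by
  refine ⟨(p / q) ^ (p / q) * c ^ (-(p / q)), by positivity, fun y hy => ?_⟩
  refine (exp_neg_le_rpow (s := p / q) (by positivity) (by positivity)).trans (le_of_eq ?_)
  rw [Real.mul_rpow hc.le (by positivity), ← Real.rpow_mul hy.le,
    show -q * -(p / q) = p by field_simp]
  ring

lemma eventually_mul_rpow_le (K : ℝ) {p r : ℝ} (hp : 0 < p) (hr : 0 < r) :
    ∀ᶠ y : ℝ in 𝓝[>] 0, K * y ^ p ≤ r := by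
  have h : Tendsto (fun y : ℝ => K * y ^ p) (𝓝[>] 0) (𝓝 (K * 0 ^ p)) :=
    ((Real.continuousAt_rpow_const 0 p (Or.inr hp.le)).tendsto.mono_left
      nhdsWithin_le_nhds).const_mul K
  rw [Real.zero_rpow hp.ne', mul_zero] at h
  exact (h.eventually (gt_mem_nhds hr)).mono fun y hy => le_of_lt hy

set_option maxHeartbeats 1000000 in
/-- The saddle point asymptotics, with an error term uniform in the saddle point `y → 0`. -/
lemma exists_saddle_bound {κ δ : ℝ} (hκ : 0 < κ) {m : ℕ} (hm : 1 ≤ m) (hδ : 0 < δ)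
    (hδ' : δ < 1 / (4 * κ)) :
    ∃ C : ℝ, 0 < C ∧ ∀ᶠ y : ℝ in 𝓝[>] 0, ∀ n : ℕ, -(deriv (psLog κ m) y).re = n →
      |(pkm κ m n : ℝ) * √(2 * π * (deriv (deriv (psLog κ m)) y).re) *
        Real.exp (-(psLog κ m y).re - n * y) - 1| ≤ C * y ^ (1 / κ - 2 * δ) := by
  have hκi : 0 < 1 / κ := by positivity
  have hq4 : 1 / (4 * κ) = (1 / κ) / 4 := by field_simp
  set k := 1 / κ with hk
  have hs : k < k + δ := by linarith
  obtain ⟨A, hA, hAb⟩ := exists_norm_psLog_le hκ m hs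
  obtain ⟨c, hc, hlow⟩ := exists_deriv_psLog_lower hκ hm
  obtain ⟨c', hc', hdec⟩ := exists_re_psLog_decay hκ hm
  rw [← hk] at hlow hdec
  set D0 := 32 * A * (1 / 2) ^ (-(k + δ)) with hD0
  have hD0p : 0 < D0 := by positivity
  obtain ⟨K1, hK1, hexp1⟩ := exists_exp_neg_rpow_le (c := c / 4) (q := k / 6) (p := k)
    (by positivity) (by positivity) hκi
  obtain ⟨K2, hK2, hexp2⟩ := exists_exp_neg_rpow_le (c := c') (q := k / 6)
    (p := (k + δ) + 1 + k) hc' (by positivity) (by positivity)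
  refine ⟨2 * (64 * (D0 / c ^ 2) + 4 * 1728 * (D0 ^ 2 / c ^ 3) + K1) + 2 * ((1 + D0) * π * K2),
    by positivity, ?_⟩
  filter_upwards [hdec, self_mem_nhdsWithin, eventually_mul_rpow_le 1 one_pos one_pos,
    eventually_mul_rpow_le 1 (p := 5 / 12 * k) (r := 1 / 4) (by positivity) (by norm_num),
    eventually_mul_rpow_le (2 * D0) (p := k / 4 - δ) (r := 1) (by linarith) one_pos]
    with y hdec hy hy1 hu4 hDu n hn
  replace hy : 0 < y := hy
  rw [one_mul, Real.rpow_one] at hy1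
  rw [one_mul] at hu4
  obtain ⟨hT, hT2, hT3⟩ := taylor_of_re_bound (by linarith) (differentiableOn_psLog hκ m) hAb hy
  have hD : 32 * (A * (y / 2) ^ (-(k + δ))) = D0 * y ^ (-(k + δ)) := by
    rw [hD0, div_eq_mul_one_div y, Real.mul_rpow hy.le (by norm_num)]
    ring
  have hM : A * (y / 2) ^ (-(k + δ)) = D0 * y ^ (-(k + δ)) / 32 := by linarith
  rw [hM] at hT hT2 hT3
  set D := D0 * y ^ (-(k + δ)) with hDdef
  have hDp : 0 < D := by positivity
  have hB := (hlow y hy hy1).2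
  have hf2 : deriv (deriv (psLog κ m)) y = ((deriv (deriv (psLog κ m)) y).re : ℂ) := by
    rw [deriv_deriv_psLog_ofReal hκ m hy, Complex.ofReal_re]
  have hf1 : deriv (psLog κ m) y = (-n : ℂ) := by
    have : deriv (psLog κ m) y = ((deriv (psLog κ m) y).re : ℂ) := by
      rw [deriv_psLog_ofReal hκ m hy, Complex.ofReal_re]
    rw [this, ← neg_neg (deriv (psLog κ m) y).re, hn]
    push_cast
    rfl
  have hf3 : deriv (deriv (deriv (psLog κ m))) y
      = ((deriv (deriv (deriv (psLog κ m))) y).re : ℂ) :=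
    Complex.ext (by simp) (by simp [deriv_deriv_deriv_psLog_im hκ m hy])
  set B := (deriv (deriv (psLog κ m)) y).re with hBdef
  set F3 := (deriv (deriv (deriv (psLog κ m))) y).re with hF3
  set b := y ^ 2 * B with hb
  set u₀ := y ^ (5 / 12 * k) with hu0
  have hu0p : 0 < u₀ := by positivity
  have hblow : c * y ^ (-k) ≤ b := by
    rw [hb]
    calc c * y ^ (-k) = y ^ 2 * (c * (y ^ (-k) * (1 / y) ^ 2)) := by field_simp
      _ ≤ _ := by gcongr
  have hbp : 0 < b := lt_of_lt_of_le (by positivity) hblow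
  have hbD : b ≤ D := by
    rw [hf2, Complex.norm_real, Real.norm_eq_abs, le_div_iff₀ (by positivity)] at hT2
    nlinarith [le_abs_self B, sq_nonneg y]
  have hd : |y ^ 3 * F3 / 6| ≤ D := by
    rw [hf3, Complex.norm_real, Real.norm_eq_abs, le_div_iff₀ (by positivity)] at hT3
    rw [abs_div, abs_mul, abs_of_pos (by positivity : 0 < y ^ 3),
      abs_of_pos (by norm_num : (0 : ℝ) < 6)]
    nlinarith
  have hDu3 : 2 * D * u₀ ^ 3 ≤ 1 := by
    refine le_trans (le_of_eq ?_) hDu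
    rw [hDdef, hu0, ← Real.rpow_natCast, ← Real.rpow_mul hy.le, mul_assoc, mul_assoc,
      ← Real.rpow_add hy, ← mul_assoc]
    congr 2
    push_cast
    ring
  have hu0sq : u₀ ^ 2 * y ^ (-k) = y ^ (-(k / 6)) := by
    rw [hu0, ← Real.rpow_natCast, ← Real.rpow_mul hy.le, ← Real.rpow_add hy]
    congr 1
    push_cast
    ring
  set η := Real.exp (-(c' * y ^ (-(k / 6)))) with hη
  have hcont : Continuous fun u : ℝ => psLog κ m (y + (y * u : ℝ) * Complex.I) - psLog κ m y +
      n * ((y * u : ℝ) * Complex.I) := by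
    have h1 : Continuous fun u : ℝ => psLog κ m (y + (y * u : ℝ) * Complex.I) :=
      (differentiableOn_psLog hκ m).continuousOn.comp_continuous (by fun_prop) (fun u => by
        simpa using hy)
    fun_prop
  have huT : u₀ ≤ π / y := by
    rw [le_div_iff₀ hy]
    nlinarith [Real.pi_gt_three]
  have hΨ1 : ∀ u : ℝ, |u| ≤ u₀ →
      ‖psLog κ m (y + (y * u : ℝ) * Complex.I) - psLog κ m y + n * ((y * u : ℝ) * Complex.I) +
        b * u ^ 2 / 2 + Complex.I * (y ^ 3 * F3 / 6 : ℝ) * u ^ 3‖ ≤ D * u ^ 4 := by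
    intro u hu
    have hw : ‖((y * u : ℝ) * Complex.I : ℂ)‖ = y * |u| := by
      rw [norm_mul, Complex.norm_I, mul_one, Complex.norm_real, Real.norm_eq_abs, abs_mul,
        abs_of_pos hy]
    have h1 := hT ((y * u : ℝ) * Complex.I) (by
      rw [hw]
      nlinarith)
    rw [hw, hf1, hf2, hf3, mul_div_cancel_left₀ _ hy.ne', Even.pow_abs (by decide)] at h1
    have hI2 : Complex.I ^ 2 = -1 := Complex.I_sq
    have hI3 : Complex.I ^ 3 = -Complex.I := Complex.I_pow_three
    refine le_trans (le_of_eq ?_) (h1.trans (le_of_eq (by ring)))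
    congr 1
    rw [hb, mul_pow _ Complex.I, mul_pow _ Complex.I, hI2, hI3]
    push_cast
    ring
  have hΨ2 : ∀ u : ℝ, u₀ ≤ |u| → |u| ≤ π / y →
      (psLog κ m (y + (y * u : ℝ) * Complex.I) - psLog κ m y +
        n * ((y * u : ℝ) * Complex.I)).re ≤ Real.log η := by
    intro u hu1 hu2
    have h1 := hdec (y * u) (by
      rw [abs_mul, abs_of_pos hy]
      rw [le_div_iff₀ hy] at hu2
      linarith)
    rw [mul_div_cancel_left₀ _ hy.ne'] at h1
    have h2 : u₀ ^ 2 ≤ min (u ^ 2) 1 := by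
      apply le_min
      · rw [← sq_abs u]
        gcongr
      · exact pow_le_one₀ hu0p.le (by linarith)
    have h3 : c' * y ^ (-(k / 6)) ≤ c' * (min (u ^ 2) 1 * y ^ (-k)) := by
      rw [← hu0sq]
      gcongr
    rw [hη, Real.log_exp, Complex.add_re, Complex.sub_re]
    have h4 : ((n : ℂ) * ((y * u : ℝ) * Complex.I)).re = 0 := by simp
    rw [h4]
    linarith
  have key := laplace_bound hcont hbp hd hu0p (by linarith) huT hDu3 (Real.exp_pos _) hΨ1 hΨ2
  rw [pkm_mul_eq_integral hκ m n hy B]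
  refine key.trans ?_
  set X := y ^ (k - 2 * δ) with hX
  have hXmono : ∀ p, k - 2 * δ ≤ p → y ^ p ≤ X := fun p hp =>
    Real.rpow_le_rpow_of_exponent_ge hy hy1 hp
  have t1 : D / b ^ 2 ≤ D0 / c ^ 2 * X := by
    calc D / b ^ 2 ≤ D / (c * y ^ (-k)) ^ 2 := by gcongr
      _ = D0 / c ^ 2 * y ^ (k - δ) := by
        rw [hDdef, mul_pow, mul_div_mul_comm, ← Real.rpow_natCast (y ^ (-k)), ← Real.rpow_mul hy.le,
          ← Real.rpow_sub hy]
        congr 2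
        push_cast
        ring
      _ ≤ _ := by
        gcongr
        exact hXmono _ (by linarith)
  have t2 : D ^ 2 / b ^ 3 ≤ D0 ^ 2 / c ^ 3 * X := by
    calc D ^ 2 / b ^ 3 ≤ D ^ 2 / (c * y ^ (-k)) ^ 3 := by gcongr
      _ = D0 ^ 2 / c ^ 3 * X := by
        rw [hDdef, mul_pow D0, mul_pow c, mul_div_mul_comm, ← Real.rpow_natCast (y ^ (-k)),
          ← Real.rpow_natCast (y ^ (-(k + δ))), ← Real.rpow_mul hy.le,
          ← Real.rpow_mul hy.le, ← Real.rpow_sub hy]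
        congr 2
        push_cast
        ring
  have t3 : Real.exp (-(b / 4 * u₀ ^ 2)) ≤ K1 * X := by
    refine le_trans (Real.exp_le_exp.2 (neg_le_neg ?_)) ((hexp1 y hy).trans ?_)
    · rw [← hu0sq]
      calc _ = (c * y ^ (-k)) / 4 * u₀ ^ 2 := by ring
        _ ≤ _ := by gcongr
    · gcongr
      exact hXmono _ (by linarith)
  have t4 : √b * (π / y) * η ≤ (1 + D0) * π * K2 * X := by
    have h1 : √b ≤ (1 + D0) * y ^ (-(k + δ)) := by
      have h2 : √b ≤ 1 + b := by
        rw [Real.sqrt_le_left (by positivity)]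
        nlinarith
      have h3 : (1 : ℝ) ≤ y ^ (-(k + δ)) :=
        Real.one_le_rpow_of_pos_of_le_one_of_nonpos hy hy1 (by linarith)
      linarith
    calc √b * (π / y) * η ≤ ((1 + D0) * y ^ (-(k + δ))) * (π / y) *
          (K2 * y ^ ((k + δ) + 1 + k)) := by
          gcongr
          exact hexp2 y hy
      _ = (1 + D0) * π * K2 * y ^ k := by
          rw [Real.rpow_add hy, Real.rpow_add hy, Real.rpow_one, Real.rpow_neg hy.le]
          field_simp
      _ ≤ _ := by
          gcongr
          exact hXmono _ (by linarith)
  calc _ = 2 * (64 * (D / b ^ 2) + 4 * 1728 * (D ^ 2 / b ^ 3) + Real.exp (-(b / 4 * u₀ ^ 2))) +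
        2 * (√b * (π / y) * η) := by ring
    _ ≤ 2 * (64 * (D0 / c ^ 2 * X) + 4 * 1728 * (D0 ^ 2 / c ^ 3 * X) + K1 * X) +
        2 * ((1 + D0) * π * K2 * X) := by gcongr
    _ = _ := by ring

lemma exists_saddle_point {κ : ℝ} (hκ : 0 < κ) {m : ℕ} (hm : 1 ≤ m) {y₀ : ℝ} (hy₀ : 0 < y₀)
    (hy₁ : y₀ ≤ 1) {t : ℝ} (ht : -(deriv (psLog κ m) y₀).re ≤ t) :
    ∃ y : ℝ, 0 < y ∧ y ≤ y₀ ∧ -(deriv (psLog κ m) y).re = t := by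
  obtain ⟨c, hc, hlow⟩ := exists_deriv_psLog_lower hκ hm
  obtain ⟨y₁, hy1, h1, h2⟩ : ∃ y₁ : ℝ, 0 < y₁ ∧ y₁ ≤ y₀ ∧ t ≤ -(deriv (psLog κ m) y₁).re := by
    have h3 := (tendsto_rpow_neg_one_div hκ).eventually_ge_atTop (|t| / c)
    have h4 : ∀ᶠ y : ℝ in 𝓝[>] 0, y < y₀ := nhdsWithin_le_nhds (gt_mem_nhds hy₀)
    obtain ⟨y, ⟨h5, h6⟩, h7⟩ := ((h3.and h4).and self_mem_nhdsWithin).exists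
    replace h7 : 0 < y := h7
    refine ⟨y, h7, h6.le, le_trans ?_ (hlow y h7 (h6.le.trans hy₁)).1⟩
    rw [div_le_iff₀ hc] at h5
    have h8 : 1 ≤ 1 / y := by
      rw [le_div_iff₀ h7]
      linarith
    have h9 : 0 < y ^ (-(1 / κ)) := by positivity
    calc t ≤ |t| := le_abs_self t
      _ ≤ y ^ (-(1 / κ)) * c := h5
      _ ≤ (y ^ (-(1 / κ)) * c) * (1 / y) := le_mul_of_one_le_right (by positivity) h8
      _ = _ := by ring
  have hcont : ContinuousOn (fun y : ℝ => -(deriv (psLog κ m) y).re) (Set.Icc y₁ y₀) := by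
    have h3 : ContinuousOn (fun y : ℝ => deriv (psLog κ m) y) (Set.Icc y₁ y₀) :=
      ((differentiableOn_psLog hκ m).deriv isOpen_re_pos).continuousOn.comp
        Complex.continuous_ofReal.continuousOn (fun y hy => by
          simpa using hy1.trans_le hy.1)
    exact (Complex.continuous_re.comp_continuousOn h3).neg
  obtain ⟨y, hy, hyt⟩ := intermediate_value_Icc' h1 hcont ⟨ht, h2⟩
  exact ⟨y, hy1.trans_le hy.1, hy.2, hyt⟩

lemma exists_exponent {κ ε : ℝ} (hκ : 0 < κ) (hε : 0 < ε) :
    ∃ δ : ℝ, 0 < δ ∧ δ < 1 / (4 * κ) ∧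
      1 / (κ + 1) - ε ≤ (1 / κ - 2 * δ) / (1 / κ + δ + 1) := by
  have h1 : Tendsto (fun δ : ℝ => (1 / κ - 2 * δ) / (1 / κ + δ + 1)) (𝓝[>] 0)
      (𝓝 ((1 / κ - 2 * 0) / (1 / κ + 0 + 1))) := by
    have : ContinuousAt (fun δ : ℝ => (1 / κ - 2 * δ) / (1 / κ + δ + 1)) 0 :=
      ContinuousAt.div (by fun_prop) (by fun_prop) (by positivity)
    exact this.tendsto.mono_left nhdsWithin_le_nhds
  have e : (1 / κ - 2 * 0) / (1 / κ + 0 + 1) = 1 / (κ + 1) := by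
    field_simp
    ring
  rw [e] at h1
  have h2 := h1.eventually (lt_mem_nhds (show 1 / (κ + 1) - ε < 1 / (κ + 1) by linarith))
  have h3 : ∀ᶠ δ : ℝ in 𝓝[>] 0, δ < 1 / (4 * κ) :=
    nhdsWithin_le_nhds (gt_mem_nhds (by positivity))
  obtain ⟨δ, ⟨h4, h5⟩, h6⟩ := ((h2.and h3).and self_mem_nhdsWithin).exists
  exact ⟨δ, h6, h5, h4.le⟩

theorem stmt9 (κ ε : ℝ) (m : ℕ) (hm : 1 ≤ m) (hκ : 0 < κ)
    (hε : ε ∈ Set.Ioo 0 (1 / (κ + 1))) :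
    ∃ C > 0, ∃ N₀ : ℕ, ∀ n ≥ N₀, ∃ y > 0,
      deriv (Lk κ) y - ((m : ℝ) + 1) * deriv (Lk κ) (((m : ℝ) + 1) * y) + (n : ℝ) = 0 ∧
      |(pkm κ m n : ℝ) *
          Real.sqrt (2 * π * (deriv (deriv (Lk κ)) y -
            ((m : ℝ) + 1) ^ 2 * deriv (deriv (Lk κ)) (((m : ℝ) + 1) * y))) *
          Real.exp (-(Lk κ y - Lk κ (((m : ℝ) + 1) * y)) - (n : ℝ) * y) - 1|
        ≤ C * (n : ℝ) ^ (-(1 / (κ + 1)) + ε) := by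
  obtain ⟨δ, hδ, hδ', hexp⟩ := exists_exponent hκ hε.1
  have hκi : 0 < 1 / κ := by positivity
  have hq4 : 1 / (4 * κ) = (1 / κ) / 4 := by field_simp
  obtain ⟨C, hC, hbound⟩ := exists_saddle_bound hκ hm hδ hδ'
  obtain ⟨A, hA, hAb⟩ := exists_norm_psLog_le hκ m (s := 1 / κ + δ) (by linarith)
  set s := 1 / κ + δ with hs
  have hs0 : 0 < s := by positivity
  set A' := 2 ^ (s + 1) * A with hA'
  have hA'p : 0 < A' := by positivity
  have hbound' := hbound.and ((nhdsWithin_le_nhds (gt_mem_nhds one_pos) :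
    ∀ᶠ y : ℝ in 𝓝[>] 0, y < 1))
  obtain ⟨y₁, hy₁, hsub⟩ := mem_nhdsGT_iff_exists_Ioc_subset.1 hbound'
  replace hy₁ : 0 < y₁ := hy₁
  have hy₁1 : y₁ ≤ 1 := (hsub ⟨hy₁, le_rfl⟩).2.le
  set p := 1 / κ - 2 * δ with hp
  have hp0 : 0 < p := by
    rw [hp]
    linarith
  refine ⟨C * A' ^ (p / (s + 1)), by positivity,
    max 1 ⌈-(deriv (psLog κ m) y₁).re⌉₊, fun n hn => ?_⟩
  have hn1 : (1 : ℝ) ≤ n := by exact_mod_cast (le_max_left _ _).trans hn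
  have hn2 : -(deriv (psLog κ m) y₁).re ≤ n :=
    (Nat.le_ceil _).trans (by exact_mod_cast (le_max_right _ _).trans hn)
  obtain ⟨y, hy, hyle, hyn⟩ := exists_saddle_point hκ hm hy₁ hy₁1 hn2
  have hmain := (hsub ⟨hy, hyle⟩).1 n hyn
  rw [deriv_deriv_psLog_ofReal hκ m hy, psLog_ofReal hκ m hy, Complex.ofReal_re,
    Complex.ofReal_re] at hmain
  refine ⟨y, hy, ?_, hmain.trans ?_⟩
  · rw [deriv_psLog_ofReal hκ m hy, Complex.ofReal_re] at hyn
    linarith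
  have h1 : (n : ℝ) ≤ A' * y ^ (-(s + 1)) := by
    have h2 := norm_deriv_le_of_re_bound hs0.le (differentiableOn_psLog hκ m) hAb (z := y)
      (by simpa using hy)
    rw [Complex.ofReal_re] at h2
    rw [← hyn]
    exact (neg_le_abs _).trans ((Complex.abs_re_le_norm _).trans h2)
  have h2 : y ^ (s + 1) ≤ A' * (n : ℝ)⁻¹ := by
    rw [Real.rpow_neg hy.le, ← div_eq_mul_inv, le_div_iff₀ (by positivity)] at h1
    rw [← div_eq_mul_inv, le_div_iff₀ (by linarith)]
    linarith
  have h3 : y ^ p ≤ A' ^ (p / (s + 1)) * (n : ℝ) ^ (-(p / (s + 1))) := by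
    have h4 := Real.rpow_le_rpow (by positivity) h2 (by positivity : 0 ≤ p / (s + 1))
    rw [← Real.rpow_mul hy.le, mul_div_cancel₀ _ (by positivity), Real.mul_rpow hA'p.le
      (by positivity), Real.inv_rpow (by positivity), ← Real.rpow_neg (by positivity)] at h4
    exact h4
  calc C * y ^ p ≤ C * (A' ^ (p / (s + 1)) * (n : ℝ) ^ (-(p / (s + 1)))) := by gcongr
    _ ≤ C * (A' ^ (p / (s + 1)) * (n : ℝ) ^ (-(1 / (κ + 1)) + ε)) := by
        gcongr
        linarith
    _ = _ := by ring
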